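/- There exists an absolute constant C (independent of α, N and f) such that the following holds. Let α ∈ [0,1] and let N : ℝ → (0,∞) be a Lipschitz function with Lip(N) ≤ 1/(α+1). Then for every f : ℝ → ℝ of bounded variation, V(M^α_N f) ≤ C V(f). Moreover, for every β > 1/(α+1) there exist a function N_β : ℝ → (0,∞) with Lip(N_β) = β such that, for f = χ_{(-1,0)}, one has V(M^α_{N_β} f) = +∞. -/

import Mathlib

open MeasureTheory Set Filter Topology NNReal ENNReal

/-- The average of `|f|` over the interval `[y - t, y + t]`. -/
noncomputable def avgAbs (f : ℝ → ℝ) (y t : ℝ) : ℝ :=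
  (1 / (2 * t)) * ∫ s in (y - t)..(y + t), |f s|

/-- The nontangential Lipschitz-truncated maximal function
`M^α_N f (x) = sup { (1/(2t)) ∫_{y-t}^{y+t} |f| : 0 < t ≤ N(x), |x - y| ≤ α t }`. -/
noncomputable def ntTruncMax (α : ℝ) (N : ℝ → ℝ) (f : ℝ → ℝ) (x : ℝ) : ℝ :=
  sSup {r : ℝ | ∃ y t : ℝ, 0 < t ∧ t ≤ N x ∧ |x - y| ≤ α * t ∧ r = avgAbs f y t}

/-- The Lipschitz constant `Lip(N) = sup_{x ≠ y} |N(x) - N(y)| / |x - y|`, valued in `ℝ≥0∞`. -/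
noncomputable def lipConst (N : ℝ → ℝ) : ℝ≥0∞ :=
  ⨆ (x : ℝ) (y : ℝ) (_ : x ≠ y), ENNReal.ofReal (|N x - N y| / |x - y|)

/-- The successor of `a` in the finite set `Q`, and `a` itself if there is none. -/
noncomputable def nextIn (Q : Finset ℝ) (a : ℝ) : ℝ :=
  if h : (Q.filter (a < ·)).Nonempty then (Q.filter (a < ·)).min' h else a

theorem le_nextIn (Q : Finset ℝ) (a : ℝ) : a ≤ nextIn Q a := by
  unfold nextIn
  split_ifs with h
  · exact ((Finset.mem_filter.1 (Finset.min'_mem _ h)).2).le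
  · exact le_rfl

theorem nextIn_le {Q : Finset ℝ} {a b : ℝ} (hb : b ∈ Q) (hab : a < b) : nextIn Q a ≤ b := by
  have hb' : b ∈ Q.filter (a < ·) := Finset.mem_filter.2 ⟨hb, hab⟩
  unfold nextIn
  rw [dif_pos ⟨b, hb'⟩]
  exact Finset.min'_le _ _ hb'

theorem nextIn_mem {Q : Finset ℝ} {a b : ℝ} (hb : b ∈ Q) (hab : a < b) :
    nextIn Q a ∈ Q ∧ a < nextIn Q a := by
  have hb' : b ∈ Q.filter (a < ·) := Finset.mem_filter.2 ⟨hb, hab⟩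
  unfold nextIn
  rw [dif_pos ⟨b, hb'⟩]
  exact Finset.mem_filter.1 (Finset.min'_mem _ ⟨b, hb'⟩)

/-- Increments of a monotone function between successive points of a finite set telescope. -/
theorem sum_nextIn_le {T : ℝ → ℝ} (hT : Monotone T) (Q : Finset ℝ) :
    ∀ b, (∀ a ∈ Q, b ≤ a) → ∃ y, b ≤ y ∧ ∑ a ∈ Q, (T (nextIn Q a) - T a) ≤ T y - T b := by
  induction Q using Finset.induction_on_min with
  | empty => intro b _; exact ⟨b, le_rfl, by simp⟩
  | insert m Q hm ih =>
    intro b hb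
    have hbm : T b ≤ T m := hT (hb m (Finset.mem_insert_self _ _))
    have hmQ : m ∉ Q := fun h => lt_irrefl _ (hm m h)
    have hsame : ∀ a ∈ Q, nextIn (insert m Q) a = nextIn Q a := by
      intro a ha
      have : (insert m Q).filter (a < ·) = Q.filter (a < ·) := by
        rw [Finset.filter_insert, if_neg (not_lt.2 (hm a ha).le)]
      simp only [nextIn, this]
    rw [Finset.sum_insert hmQ,
      Finset.sum_congr rfl (fun a ha => by rw [hsame a ha] :
        ∀ a ∈ Q, T (nextIn (insert m Q) a) - T a = T (nextIn Q a) - T a)]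
    rcases Q.eq_empty_or_nonempty with rfl | hne
    · have hself : nextIn (insert m ∅) m = m := by
        unfold nextIn
        rw [dif_neg (by simp)]
      exact ⟨b, le_rfl, by rw [Finset.sum_empty, hself]; simp⟩
    · obtain ⟨y, hy, hs⟩ := ih (Q.min' hne) (fun a ha => Finset.min'_le _ _ ha)
      have h1 : nextIn (insert m Q) m ≤ Q.min' hne :=
        nextIn_le (Finset.mem_insert_of_mem (Finset.min'_mem _ hne)) (hm _ (Finset.min'_mem _ hne))
      refine ⟨y, ?_, ?_⟩
      · exact ((hb m (Finset.mem_insert_self _ _)).trans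
          (hm _ (Finset.min'_mem _ hne)).le).trans hy
      · linarith [hT h1]

/-- A finite family of wells of a function of bounded variation: over `(u i, v i)` the function lies
on average `e i * L i / (v i - u i)` below the level `m i`, which it reaches on both sides. -/
theorem sum_wells_le {ι : Type*} (s : Finset ι) {g T : ℝ → ℝ} {V B : ℝ} (hg : Measurable g)
    (hgi : ∀ a b, IntervalIntegrable g volume a b)
    (hT : ∀ x y, x ≤ y → |g y - g x| ≤ T y - T x) (hV : ∀ x y, x ≤ y → T y - T x ≤ V)
    (hB0 : 0 ≤ B)
    (σ u v τ m L e : ι → ℝ)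
    (hσ : ∀ i ∈ s, σ i ≤ u i) (huv : ∀ i ∈ s, u i < v i) (hvτ : ∀ i ∈ s, v i ≤ τ i)
    (hmσ : ∀ i ∈ s, m i ≤ g (σ i)) (hmτ : ∀ i ∈ s, m i ≤ g (τ i))
    (hL : ∀ i ∈ s, 0 < L i) (hτσ : ∀ i ∈ s, τ i - σ i ≤ 4 * L i)
    (hB : ∀ z l : ℝ, 0 < l →
      ∑ i ∈ s with (u i < z ∧ z ≤ v i ∧ l ≤ L i), 1 / L i ≤ B / l)
    (he : ∀ i ∈ s, e i * L i ≤ ∫ z in u i..v i, (m i - g z)) :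
    ∑ i ∈ s, e i ≤ 4 * B * V := by
  classical
  have hTm : Monotone T := fun x y h => by linarith [hT x y h, abs_nonneg (g y - g x)]
  set P : Finset ℝ := s.image σ ∪ s.image τ with hP
  set R : ι → Set (ℝ × ℝ) := fun i => {w | u i < w.1 ∧ w.1 ≤ v i ∧ g w.1 ≤ w.2 ∧ w.2 < m i} with hR
  have hRm : ∀ i, MeasurableSet (R i) := by
    intro i
    have h1 : MeasurableSet {w : ℝ × ℝ | u i < w.1} :=
      measurableSet_lt measurable_const measurable_fst
    have h2 : MeasurableSet {w : ℝ × ℝ | w.1 ≤ v i} :=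
      measurableSet_le measurable_fst measurable_const
    have h3 : MeasurableSet {w : ℝ × ℝ | g w.1 ≤ w.2} :=
      measurableSet_le (hg.comp measurable_fst) measurable_snd
    have h4 : MeasurableSet {w : ℝ × ℝ | w.2 < m i} :=
      measurableSet_lt measurable_snd measurable_const
    exact h1.inter (h2.inter (h3.inter h4))
  set F : ℝ → ℝ → ℝ≥0∞ := fun z l =>
    ∑ i ∈ s, (R i).indicator (fun _ => ENNReal.ofReal (1 / L i)) (z, l)
    with hF
  have hFm : Measurable (Function.uncurry F) := by
    have : Function.uncurry F
        = fun w => ∑ i ∈ s, (R i).indicator (fun _ => ENNReal.ofReal (1 / L i)) w := by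
      funext w; rfl
    rw [this]
    exact Finset.measurable_sum _ (fun i _ => measurable_const.indicator (hRm i))
  have hlow : ENNReal.ofReal (∑ i ∈ s, e i) ≤ ∫⁻ z, ∫⁻ l, F z l := by
    have hc : ∀ i z, ∫⁻ l, (R i).indicator (fun _ => ENNReal.ofReal (1 / L i)) (z, l)
        = (Set.Ioc (u i) (v i)).indicator
          (fun z => ENNReal.ofReal (1 / L i) * ENNReal.ofReal (m i - g z)) z := by
      intro i z
      by_cases hz : z ∈ Set.Ioc (u i) (v i)
      · rw [Set.indicator_of_mem hz, ← Real.volume_Ico,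
          ← lintegral_indicator_const measurableSet_Ico]
        refine lintegral_congr fun l => ?_
        simp only [Set.indicator_apply, hR, Set.mem_ofPred_eq, Set.mem_Ico, hz.1, hz.2, true_and]
      · rw [Set.indicator_of_notMem hz]
        have : ∀ l, (z, l) ∉ R i := fun l hl => hz ⟨hl.1, hl.2.1⟩
        simp [Set.indicator_of_notMem (this _)]
    have hmz : ∀ i z, Measurable fun l =>
        (R i).indicator (fun _ => ENNReal.ofReal (1 / L i)) (z, l) :=
      fun i z => (measurable_const.indicator (hRm i)).comp measurable_prodMk_left
    have hmg : ∀ i, Measurable fun z => ENNReal.ofReal (m i - g z) :=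
      fun i => (measurable_const.sub hg).ennreal_ofReal
    calc ENNReal.ofReal (∑ i ∈ s, e i) ≤ ∑ i ∈ s, ENNReal.ofReal (e i) :=
          Finset.le_sum_of_subadditive _ (by simp) (fun _ _ => ENNReal.ofReal_add_le) _ _
      _ ≤ ∑ i ∈ s, ∫⁻ z, ∫⁻ l, (R i).indicator (fun _ => ENNReal.ofReal (1 / L i)) (z, l) := by
          refine Finset.sum_le_sum fun i hi => ?_
          rw [lintegral_congr (hc i), lintegral_indicator measurableSet_Ioc,
            lintegral_const_mul _ (hmg i)]
          have h1 : e i ≤ 1 / L i * ∫ z in u i..v i, (m i - g z) := by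
            rw [one_div, inv_mul_eq_div, le_div_iff₀ (hL i hi)]
            exact he i hi
          refine (ENNReal.ofReal_le_ofReal h1).trans ?_
          rw [ENNReal.ofReal_mul (by have := hL i hi; positivity),
            intervalIntegral.integral_of_le (huv i hi).le]
          gcongr
          have hint : IntegrableOn (fun z => m i - g z) (Set.Ioc (u i) (v i)) :=
            (intervalIntegrable_const.sub (hgi (u i) (v i))).1
          calc _ ≤ ENNReal.ofReal (∫ z in Set.Ioc (u i) (v i), max (m i - g z) 0) :=
                ENNReal.ofReal_le_ofReal
                  (integral_mono hint (hint.sup (integrable_zero _ _ _)) fun z => le_max_left _ _)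
            _ = ∫⁻ z in Set.Ioc (u i) (v i), ENNReal.ofReal (max (m i - g z) 0) :=
                ofReal_integral_eq_lintegral_ofReal (hint.sup (integrable_zero _ _ _))
                  (Eventually.of_forall fun z => le_max_right _ _)
            _ = _ := lintegral_congr fun z => by simp
      _ = ∫⁻ z, ∫⁻ l, F z l := by
          simp only [hF]
          rw [← lintegral_finsetSum]
          · refine lintegral_congr fun z => ?_
            rw [lintegral_finsetSum _ fun i _ => hmz i z]
          · intro i _
            rw [funext (hc i)]
            exact ((hmg i).const_mul _).indicator measurableSet_Ioc
  have hup : ∀ l, ∫⁻ z, F z l ≤ ∑ a ∈ P,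
      (Set.Ico (g a - (T (nextIn P a) - T a)) (g a)).indicator
        (fun _ => ENNReal.ofReal (4 * B)) l := by
    intro l
    set S := P.filter (l < g ·) with hS
    set H : ℝ → ℝ → ℝ≥0∞ := fun a z =>
      (Set.Ico (g a - (T (nextIn P a) - T a)) (g a)).indicator
        (fun _ => (Set.Ico a (nextIn S a)).indicator
          (fun _ => ENNReal.ofReal (4 * B / (nextIn S a - a))) z) l with hH
    have hpt : ∀ z, F z l ≤ ∑ a ∈ P, H a z := by
      intro z
      have hFz : F z l = ∑ i ∈ s with (z, l) ∈ R i, ENNReal.ofReal (1 / L i) := by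
        simp only [hF, Set.indicator_apply, Finset.sum_filter]
      rw [hFz]
      rcases (s.filter fun i => (z, l) ∈ R i).eq_empty_or_nonempty with h0 | ⟨i₀, hi₀⟩
      · rw [h0]; simp
      have hact : ∀ i ∈ s.filter (fun i => (z, l) ∈ R i),
          σ i ∈ S ∧ σ i < z ∧ τ i ∈ S ∧ z < τ i := by
        intro i hi
        obtain ⟨his, h1, h2, h3, h4⟩ := Finset.mem_filter.1 hi
        simp only at h1 h2 h3 h4
        refine ⟨?_, (hσ i his).trans_lt h1, ?_, ?_⟩
        · exact Finset.mem_filter.2 ⟨Finset.mem_union_left _ (Finset.mem_image_of_mem _ his),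
            h4.trans_le (hmσ i his)⟩
        · exact Finset.mem_filter.2 ⟨Finset.mem_union_right _ (Finset.mem_image_of_mem _ his),
            h4.trans_le (hmτ i his)⟩
        · refine lt_of_le_of_ne (h2.trans (hvτ i his)) ?_
          intro h
          have := hmτ i his
          rw [← h] at this
          linarith
      have hgz : g z ≤ l := (Finset.mem_filter.1 hi₀).2.2.2.1
      obtain ⟨hs1, hs2, hs3, hs4⟩ := hact i₀ hi₀
      have hne : (S.filter (· < z)).Nonempty := ⟨σ i₀, Finset.mem_filter.2 ⟨hs1, hs2⟩⟩
      obtain ⟨haS, haz⟩ := Finset.mem_filter.1 (Finset.max'_mem _ hne)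
      set a := (S.filter (· < z)).max' hne with ha
      obtain ⟨hbS, hab⟩ := nextIn_mem hs3 (haz.trans hs4)
      have hzb : z < nextIn S a := by
        by_contra hcon
        rcases (not_lt.1 hcon).lt_or_eq with h | h
        · have := Finset.le_max' _ _ (Finset.mem_filter.2 ⟨hbS, h⟩ : nextIn S a ∈ S.filter (· < z))
          exact absurd hab (not_lt.2 this)
        · have h5 := (Finset.mem_filter.1 hbS).2
          rw [h] at h5
          linarith
      obtain ⟨haP, hla⟩ := Finset.mem_filter.1 haS
      obtain ⟨hcP, hac⟩ := nextIn_mem (Finset.mem_filter.1 hs3).1 (haz.trans hs4)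
      have hla' : g a - (T (nextIn P a) - T a) ≤ l := by
        rcases lt_or_ge (nextIn P a) z with h | h
        · have h6 : g (nextIn P a) ≤ l := by
            by_contra hcon
            have := Finset.le_max' _ _ (Finset.mem_filter.2
              ⟨Finset.mem_filter.2 ⟨hcP, not_le.1 hcon⟩, h⟩ : nextIn P a ∈ S.filter (· < z))
            exact absurd hac (not_lt.2 this)
          have := (abs_le.1 (hT a (nextIn P a) hac.le)).1
          linarith
        · have := (abs_le.1 (hT a z haz.le)).1
          linarith [hTm h]
      have hHa : H a z = ENNReal.ofReal (4 * B / (nextIn S a - a)) := by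
        simp only [hH]
        rw [Set.indicator_of_mem (Set.mem_Ico.2 ⟨hla', hla⟩),
          Set.indicator_of_mem (Set.mem_Ico.2 ⟨haz.le, hzb⟩)]
      refine le_trans ?_ (Finset.single_le_sum (f := fun a => H a z) (fun _ _ => zero_le) haP)
      show _ ≤ H a z
      rw [hHa, ← ENNReal.ofReal_sum_of_nonneg]
      · refine ENNReal.ofReal_le_ofReal ?_
        have hl0 : 0 < (nextIn S a - a) / 4 := by linarith
        have hBz := hB z _ hl0
        have : B / ((nextIn S a - a) / 4) = 4 * B / (nextIn S a - a) := by
          field_simp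
        rw [this] at hBz
        refine le_trans (Finset.sum_le_sum_of_subset_of_nonneg ?_ ?_) hBz
        · intro i hi
          have hi' := Finset.mem_filter.1 hi
          obtain ⟨k1, k2, k3, k4⟩ := hact i hi
          refine Finset.mem_filter.2 ⟨hi'.1, hi'.2.1, hi'.2.2.1, ?_⟩
          have k5 : σ i ≤ a := Finset.le_max' _ _ (Finset.mem_filter.2 ⟨k1, k2⟩)
          have k6 : nextIn S a ≤ τ i := nextIn_le k3 (haz.trans k4)
          have := hτσ i hi'.1
          linarith
        · intro i hi _
          have := hL i (Finset.mem_filter.1 hi).1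
          positivity
      · intro i hi
        have := hL i (Finset.mem_filter.1 hi).1
        positivity
    have hHm : ∀ a, Measurable (H a) := by
      intro a
      simp only [hH, Set.indicator_apply (Set.Ico (g a - _) _)]
      split_ifs
      · exact measurable_const.indicator measurableSet_Ico
      · exact measurable_const
    calc ∫⁻ z, F z l ≤ ∫⁻ z, ∑ a ∈ P, H a z := lintegral_mono hpt
      _ = ∑ a ∈ P, ∫⁻ z, H a z := lintegral_finsetSum _ (fun a _ => hHm a)
      _ ≤ _ := by
        refine Finset.sum_le_sum fun a _ => ?_
        simp only [hH, Set.indicator_apply (Set.Ico (g a - _) _)]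
        split_ifs
        · rw [lintegral_indicator_const measurableSet_Ico, Real.volume_Ico,
            ← ENNReal.ofReal_mul' (sub_nonneg.2 (le_nextIn _ _))]
          refine ENNReal.ofReal_le_ofReal ?_
          rcases eq_or_ne (nextIn S a - a) 0 with h | h
          · rw [h]; simp; exact hB0
          · rw [div_mul_cancel₀ _ h]
        · simp
  have hPT : ∑ a ∈ P, (T (nextIn P a) - T a) ≤ V := by
    rcases P.eq_empty_or_nonempty with h | h
    · rw [h]; simpa using (hV 0 0 le_rfl)
    · obtain ⟨y, hy, hs⟩ := sum_nextIn_le hTm P (P.min' h) (fun a ha => Finset.min'_le _ _ ha)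
      exact hs.trans (hV _ _ hy)
  have hV0 : 0 ≤ V := by simpa using (hV 0 0 le_rfl)
  have hfin : ENNReal.ofReal (∑ i ∈ s, e i) ≤ ENNReal.ofReal (4 * B * V) := by
    calc _ ≤ ∫⁻ z, ∫⁻ l, F z l := hlow
      _ = ∫⁻ l, ∫⁻ z, F z l := lintegral_lintegral_swap hFm.aemeasurable
      _ ≤ ∫⁻ l, ∑ a ∈ P, (Set.Ico (g a - (T (nextIn P a) - T a)) (g a)).indicator
            (fun _ => ENNReal.ofReal (4 * B)) l := lintegral_mono hup
      _ = ∑ a ∈ P, ENNReal.ofReal (4 * B) * ENNReal.ofReal (T (nextIn P a) - T a) := by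
          rw [lintegral_finsetSum _ (fun a _ => measurable_const.indicator measurableSet_Ico)]
          refine Finset.sum_congr rfl fun a _ => ?_
          rw [lintegral_indicator_const measurableSet_Ico, Real.volume_Ico]
          congr 2; ring
      _ = ENNReal.ofReal (4 * B) * ENNReal.ofReal (∑ a ∈ P, (T (nextIn P a) - T a)) := by
          rw [← Finset.mul_sum, ENNReal.ofReal_sum_of_nonneg]
          exact fun a _ => sub_nonneg.2 (hTm (le_nextIn _ _))
      _ ≤ ENNReal.ofReal (4 * B) * ENNReal.ofReal V := by gcongr
      _ = _ := (ENNReal.ofReal_mul (by positivity)).symm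
  exact (ENNReal.ofReal_le_ofReal_iff (by positivity)).1 hfin

theorem exists_trim_same_side {α x t h n : ℝ} (h0 : 0 ≤ α) (hx : |x| ≤ α * t)
    (hh : 0 < h) (ht : h ≤ t / 8) (hn : t - h / (1 + α) ≤ n) (hα : α ≤ 1 / 2 ∨ 0 ≤ x) :
    ∃ s, 0 < s ∧ s ≤ 2 * h ∧ t - s ≤ n ∧ |x - h + s| ≤ α * (t - s) := by
  obtain ⟨hx1, hx2⟩ := abs_le.1 hx
  have e : h / (1 + α) * (1 + α) = h := by field_simp
  have hs0 : 0 < h / (1 + α) := by positivity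
  set s := h / (1 + α)
  by_cases hc : h - x - α * t ≤ s * (1 - α)
  · refine ⟨s, hs0, by nlinarith, hn, abs_le.2 ⟨by nlinarith, by nlinarith⟩⟩
  · push Not at hc
    have hα' : α ≤ 1 / 2 := by
      rcases hα with h1 | h1
      · exact h1
      · by_contra hcon
        push Not at hcon
        by_cases hα1 : α ≤ 1
        · nlinarith [mul_nonneg hs0.le (sub_nonneg.2 hα1)]
        · nlinarith
    have e' : (h - x - α * t) / (1 - α) * (1 - α) = h - x - α * t := by
      have : 1 - α ≠ 0 := by linarith
      field_simp
    set s' := (h - x - α * t) / (1 - α)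
    have hss : s < s' := by nlinarith
    refine ⟨s', hs0.trans hss, by nlinarith, by linarith, abs_le.2 ⟨by nlinarith, ?_⟩⟩
    have key : (1 + α) * (h - x - α * t) ≤ (1 - α) * (h + α * t - x) := by
      have : 0 ≤ α * (t + x - h) := mul_nonneg h0 (by nlinarith)
      nlinarith
    have : (1 - α) * ((1 + α) * s') ≤ (1 - α) * (h + α * t - x) := by nlinarith
    have := le_of_mul_le_mul_left this (by linarith)
    linarith

theorem exists_trim_opposite_side {α x t h n : ℝ} (h0 : 1 / 2 ≤ α) (h1 : α ≤ 1) (hx : |x| ≤ α * t)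
    (hh : 0 < h) (ht : h ≤ t / 8) (hn : t - h / (1 + α) ≤ n) (hx0 : 0 ≤ x) :
    ∃ s, 0 < s ∧ s ≤ 2 * h ∧ t - s ≤ n ∧ |x - h - s| ≤ α * (t - s) := by
  obtain ⟨hx1, hx2⟩ := abs_le.1 hx
  have e : h / (1 + α) * (1 + α) = h := by field_simp
  have hs0 : 0 < h / (1 + α) := by positivity
  set s := h / (1 + α)
  refine ⟨s, hs0, by nlinarith, hn, abs_le.2 ⟨by nlinarith, ?_⟩⟩
  have := mul_nonneg hs0.le (sub_nonneg.2 h1)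
  nlinarith

theorem exists_le_of_mul_le_integral {g : ℝ → ℝ} (hgi : ∀ a b, IntervalIntegrable g volume a b)
    {a b K : ℝ} (hab : a < b) (h : (b - a) * K ≤ ∫ z in a..b, g z) :
    ∃ x, a < x ∧ x < b ∧ K ≤ g x := by
  by_contra! hcon
  have h1 : 0 < ∫ z in a..b, (K - g z) :=
    intervalIntegral.intervalIntegral_pos_of_pos_on (intervalIntegrable_const.sub (hgi a b))
      (fun x hx => sub_pos.2 (hcon x hx.1 hx.2)) hab
  rw [intervalIntegral.integral_sub intervalIntegrable_const (hgi a b),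
    intervalIntegral.integral_const, smul_eq_mul] at h1
  linarith

theorem exists_well_of_hills {g : ℝ → ℝ} (hgi : ∀ a b, IntervalIntegrable g volume a b)
    {c t A d s₁ s₂ : ℝ} (hd : 0 ≤ d) (hA : ∫ z in (c - t)..(c + t), g z = 2 * t * A)
    (h1 : 0 < s₁) (h1t : s₁ ≤ t / 4) (h2 : 0 < s₂) (h2t : s₂ ≤ t / 4)
    (hr : 2 * s₁ * (A + d) ≤ ∫ z in (c + t - 2 * s₁)..(c + t), g z)
    (hl : 2 * s₂ * (A + d) ≤ ∫ z in (c - t)..(c - t + 2 * s₂), g z) :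
    ∃ σ u v τ, c - t ≤ σ ∧ σ ≤ u ∧ u < v ∧ v ≤ τ ∧ τ ≤ c + t ∧ A + d ≤ g σ ∧ A + d ≤ g τ ∧
      t * d ≤ ∫ z in u..v, (A + d - g z) := by
  obtain ⟨σ, hσ1, hσ2, hσ⟩ := exists_le_of_mul_le_integral hgi (a := c - t) (b := c - t + 2 * s₂)
    (K := A + d) (by linarith) (by convert hl using 1; ring)
  obtain ⟨τ, hτ1, hτ2, hτ⟩ := exists_le_of_mul_le_integral hgi (a := c + t - 2 * s₁) (b := c + t)
    (K := A + d) (by linarith) (by convert hr using 1; ring)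
  refine ⟨σ, c - t + 2 * s₂, c + t - 2 * s₁, τ, hσ1.le, hσ2.le, by linarith, hτ1.le, hτ2.le,
    hσ, hτ, ?_⟩
  have e1 := intervalIntegral.integral_add_adjacent_intervals
    (hgi (c - t) (c - t + 2 * s₂)) (hgi (c - t + 2 * s₂) (c + t - 2 * s₁))
  have e2 := intervalIntegral.integral_add_adjacent_intervals
    (hgi (c - t) (c + t - 2 * s₁)) (hgi (c + t - 2 * s₁) (c + t))
  rw [intervalIntegral.integral_sub intervalIntegrable_const (hgi _ _),
    intervalIntegral.integral_const, smul_eq_mul]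
  nlinarith

/-- If `r` sees the interval of centre `c` and radius `t` with average `A`, and two points at
distance at most `t / 8` on either side of `r` have maximal function below `A` with slope at
least `k`, then the interval contains a well of depth of order `t * k`. -/
theorem exists_well_of_dense {α : ℝ} (h0 : 0 ≤ α) (h1 : α ≤ 1) {g M N : ℝ → ℝ}
    (hgi : ∀ a b, IntervalIntegrable g volume a b)
    (hM : ∀ z y t, 0 < t → t ≤ N z → |z - y| ≤ α * t →
      ∫ w in (y - t)..(y + t), g w ≤ 2 * t * M z)
    (hN : ∀ x y, N x - N y ≤ |x - y| / (1 + α)) {p r q c t A k : ℝ}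
    (ht : 0 < t) (htN : t ≤ N r) (hrc : |r - c| ≤ α * t)
    (hA : ∫ z in (c - t)..(c + t), g z = 2 * t * A)
    (hpr : p < r) (hrq : r < q) (hp8 : r - p ≤ t / 8) (hq8 : q - r ≤ t / 8) (hk : 0 ≤ k)
    (hkp : k * (r - p) ≤ A - M p) (hkq : k * (q - r) ≤ A - M q) :
    ∃ σ u v τ, c - t ≤ σ ∧ σ ≤ u ∧ u < v ∧ v ≤ τ ∧ τ ≤ c + t ∧
      A + t * k / 4 ≤ g σ ∧ A + t * k / 4 ≤ g τ ∧
      t * (t * k / 4) ≤ ∫ z in u..v, (A + t * k / 4 - g z) := by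
  have hright : ∀ z s h, 0 < s → s ≤ 2 * h → h ≤ t / 8 → k * h ≤ A - M z → t - s ≤ N z →
      |z - (c - s)| ≤ α * (t - s) →
      2 * s * (A + t * k / 4) ≤ ∫ z in (c + t - 2 * s)..(c + t), g z := by
    intro z s h hs hsh hh8 hkh hNz hz
    have e2 := intervalIntegral.integral_add_adjacent_intervals
      (hgi (c - t) (c + t - 2 * s)) (hgi (c + t - 2 * s) (c + t))
    have e3 := hM z (c - s) (t - s) (by linarith) hNz hz
    rw [show c - s - (t - s) = c - t by ring, show c - s + (t - s) = c + t - 2 * s by ring] at e3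
    have : k * s ≤ 2 * (A - M z) := by nlinarith
    have : (t - s) * (k * s) ≤ (t - s) * (2 * (A - M z)) :=
      mul_le_mul_of_nonneg_left this (by linarith)
    have : 0 ≤ (t / 4 - s) * (k * s) := mul_nonneg (by linarith) (by positivity)
    nlinarith [mul_nonneg (mul_nonneg ht.le hk) hs.le]
  have hleft : ∀ z s h, 0 < s → s ≤ 2 * h → h ≤ t / 8 → k * h ≤ A - M z → t - s ≤ N z →
      |z - (c + s)| ≤ α * (t - s) →
      2 * s * (A + t * k / 4) ≤ ∫ z in (c - t)..(c - t + 2 * s), g z := by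
    intro z s h hs hsh hh8 hkh hNz hz
    have e2 := intervalIntegral.integral_add_adjacent_intervals
      (hgi (c - t) (c - t + 2 * s)) (hgi (c - t + 2 * s) (c + t))
    have e3 := hM z (c + s) (t - s) (by linarith) hNz hz
    rw [show c + s - (t - s) = c - t + 2 * s by ring, show c + s + (t - s) = c + t by ring] at e3
    have : k * s ≤ 2 * (A - M z) := by nlinarith
    have : (t - s) * (k * s) ≤ (t - s) * (2 * (A - M z)) :=
      mul_le_mul_of_nonneg_left this (by linarith)
    have : 0 ≤ (t / 4 - s) * (k * s) := mul_nonneg (by linarith) (by positivity)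
    nlinarith [mul_nonneg (mul_nonneg ht.le hk) hs.le]
  have hNp : t - (r - p) / (1 + α) ≤ N p := by
    have := hN r p
    rw [abs_of_pos (by linarith)] at this
    linarith
  have hNq : t - (q - r) / (1 + α) ≤ N q := by
    have := hN r q
    rw [abs_of_neg (by linarith), neg_sub] at this
    linarith
  have hcr : |-(r - c)| ≤ α * t := by rwa [abs_neg]
  have hd : 0 ≤ t * k / 4 := by positivity
  rcases le_or_gt α (1 / 2) with hα | hα
  · obtain ⟨s₁, a1, a2, a3, a4⟩ :=
      exists_trim_same_side h0 hrc (sub_pos.2 hpr) hp8 hNp (Or.inl hα)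
    obtain ⟨s₂, b1, b2, b3, b4⟩ :=
      exists_trim_same_side h0 hcr (sub_pos.2 hrq) hq8 hNq (Or.inl hα)
    refine exists_well_of_hills hgi hd hA a1 (by linarith) b1 (by linarith)
      (hright p s₁ _ a1 a2 hp8 hkp a3 ?_) (hleft q s₂ _ b1 b2 hq8 hkq b3 ?_)
    · convert a4 using 2; ring
    · rw [← abs_neg]; convert b4 using 2; ring
  · rcases le_total 0 (r - c) with hx | hx
    · obtain ⟨s₁, a1, a2, a3, a4⟩ :=
        exists_trim_same_side h0 hrc (sub_pos.2 hpr) hp8 hNp (Or.inr hx)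
      obtain ⟨s₂, b1, b2, b3, b4⟩ :=
        exists_trim_opposite_side hα.le h1 hrc (sub_pos.2 hpr) hp8 hNp hx
      refine exists_well_of_hills hgi hd hA a1 (by linarith) b1 (by linarith)
        (hright p s₁ _ a1 a2 hp8 hkp a3 ?_) (hleft p s₂ _ b1 b2 hp8 hkp b3 ?_)
      · convert a4 using 2; ring
      · convert b4 using 2; ring
    · obtain ⟨s₁, a1, a2, a3, a4⟩ :=
        exists_trim_opposite_side hα.le h1 hcr (sub_pos.2 hrq) hq8 hNq (by linarith)
      obtain ⟨s₂, b1, b2, b3, b4⟩ :=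
        exists_trim_same_side h0 hcr (sub_pos.2 hrq) hq8 hNq (Or.inr (by linarith))
      refine exists_well_of_hills hgi hd hA a1 (by linarith) b1 (by linarith)
        (hright q s₁ _ a1 a2 hq8 hkq a3 ?_) (hleft q s₂ _ b1 b2 hq8 hkq b3 ?_)
      · rw [← abs_neg]; convert a4 using 2; ring
      · rw [← abs_neg]; convert b4 using 2; ring

theorem sum_zpow_neg_le (Q : Finset ℤ) :
    ∀ n₀ : ℤ, (∀ n ∈ Q, n₀ ≤ n) → ∑ n ∈ Q, 1 / (2 : ℝ) ^ n ≤ 2 / (2 : ℝ) ^ n₀ := by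
  induction Q using Finset.induction_on_min with
  | empty => intro n₀ _; rw [Finset.sum_empty]; positivity
  | insert m Q hm ih =>
    intro n₀ h
    rw [Finset.sum_insert fun h => lt_irrefl _ (hm m h)]
    have h1 := ih (m + 1) fun n hn => hm n hn
    have h2 : (2 : ℝ) ^ n₀ ≤ 2 ^ m :=
      zpow_le_zpow_right₀ (by norm_num) (h m (Finset.mem_insert_self _ _))
    have h3 : (2 : ℝ) / 2 ^ (m + 1) = 1 / 2 ^ m := by
      rw [zpow_add_one₀ (by norm_num)]; field_simp
    have h4 : (2 : ℝ) / 2 ^ m ≤ 2 / 2 ^ n₀ := by gcongr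
    have h5 : (2 : ℝ) / 2 ^ m = 1 / 2 ^ m + 1 / 2 ^ m := by ring
    linarith

theorem sum_one_div_two_zpow_le {s : Finset (ℤ × ℤ)} {z l : ℝ} (hl : 0 < l)
    (h1 : ∀ C ∈ s, l ≤ (2 : ℝ) ^ C.1)
    (h2 : ∀ C ∈ s, z / 2 ^ C.1 - 5 < C.2 ∧ (C.2 : ℝ) < z / 2 ^ C.1 + 5) :
    ∑ C ∈ s, 1 / (2 : ℝ) ^ C.1 ≤ 20 / l := by
  rcases s.eq_empty_or_nonempty with rfl | hne
  · rw [Finset.sum_empty]; positivity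
  set Q := s.image Prod.fst
  have hQ : Q.Nonempty := hne.image _
  have hcard : ∀ n ∈ Q, ∑ C ∈ s with C.1 = n, 1 / (2 : ℝ) ^ C.1 ≤ 10 * (1 / (2 : ℝ) ^ n) := by
    intro n _
    have hc : (s.filter fun C => C.1 = n).card ≤ 10 := by
      have : (s.filter fun C => C.1 = n) ⊆
          (Finset.Icc (⌊z / 2 ^ n⌋ - 4) (⌊z / 2 ^ n⌋ + 5)).image fun j => (n, j) := by
        rintro ⟨n', j⟩ hC
        obtain ⟨hCs, rfl⟩ := Finset.mem_filter.1 hC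
        obtain ⟨k1, k2⟩ := h2 _ hCs
        simp only at k1 k2 ⊢
        refine Finset.mem_image.2 ⟨j, Finset.mem_Icc.2 ⟨?_, ?_⟩, rfl⟩
        · have : ((⌊z / 2 ^ n'⌋ : ℤ) : ℝ) ≤ z / 2 ^ n' := Int.floor_le _
          have : ((⌊z / 2 ^ n'⌋ - 5 : ℤ) : ℝ) < j := by push_cast; linarith
          have := Int.cast_lt.1 this
          omega
        · have : z / (2 : ℝ) ^ n' < ⌊z / (2 : ℝ) ^ n'⌋ + 1 := Int.lt_floor_add_one _
          have : (j : ℝ) < ((⌊z / 2 ^ n'⌋ + 6 : ℤ) : ℝ) := by push_cast; linarith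
          have := Int.cast_lt.1 this
          omega
      refine (Finset.card_le_card this).trans (Finset.card_image_le.trans ?_)
      rw [Int.card_Icc]; omega
    calc _ = ∑ C ∈ s with C.1 = n, 1 / (2 : ℝ) ^ n :=
          Finset.sum_congr rfl fun C hC => by rw [(Finset.mem_filter.1 hC).2]
      _ = (s.filter fun C => C.1 = n).card * (1 / (2 : ℝ) ^ n) := by
          rw [Finset.sum_const, nsmul_eq_mul]
      _ ≤ _ := by
          gcongr
          exact_mod_cast hc
  obtain ⟨C₀, hC₀, hC₀'⟩ := Finset.mem_image.1 (Finset.min'_mem Q hQ)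
  have hmin := sum_zpow_neg_le Q (Q.min' hQ) fun n hn => Finset.min'_le _ _ hn
  have hl' : 2 / (2 : ℝ) ^ Q.min' hQ ≤ 2 / l := by
    rw [← hC₀']
    have := h1 _ hC₀
    gcongr
  calc ∑ C ∈ s, 1 / (2 : ℝ) ^ C.1
      = ∑ n ∈ Q, ∑ C ∈ s with C.1 = n, 1 / (2 : ℝ) ^ C.1 :=
        (Finset.sum_fiberwise_of_maps_to (fun C hC => Finset.mem_image_of_mem _ hC) _).symm
    _ ≤ ∑ n ∈ Q, 10 * (1 / (2 : ℝ) ^ n) := Finset.sum_le_sum hcard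
    _ = 10 * ∑ n ∈ Q, 1 / (2 : ℝ) ^ n := (Finset.mul_sum _ _ _).symm
    _ ≤ 10 * (2 / l) := by linarith
    _ = 20 / l := by ring

/-- Wells of slope `k i` at location `r i` and scale `t i` can be dominated by a monotone function
of total variation controlled by that of `g`. -/
theorem exists_monotone_slope {ι : Type*} (D : Finset ι) {g T : ℝ → ℝ} {V : ℝ} (hg : Measurable g)
    (hgi : ∀ a b, IntervalIntegrable g volume a b)
    (hT : ∀ x y, x ≤ y → |g y - g x| ≤ T y - T x) (hV : ∀ x y, x ≤ y → T y - T x ≤ V)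
    (r t k : ι → ℝ) (ht : ∀ i ∈ D, 0 < t i) (hk : ∀ i ∈ D, 0 ≤ k i)
    (hw : ∀ i ∈ D, ∃ σ u v τ m, r i - 2 * t i ≤ σ ∧ σ ≤ u ∧ u < v ∧ v ≤ τ ∧ τ ≤ r i + 2 * t i ∧
      τ - σ ≤ 2 * t i ∧ m ≤ g σ ∧ m ≤ g τ ∧ t i * (t i * k i / 4) ≤ ∫ z in u..v, (m - g z)) :
    ∃ K : ℝ → ℝ, Monotone K ∧ (∀ x y, K y - K x ≤ 960 * V) ∧
      ∀ i ∈ D, ∃ κ, k i ≤ κ ∧ ∀ x y, r i - t i / 8 ≤ x → x ≤ y → y ≤ r i + t i / 8 →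
        κ * (y - x) ≤ K y - K x := by
  classical
  set cls : ι → ℤ × ℤ := fun i => (Int.log 2 (t i), ⌊r i / 2 ^ Int.log 2 (t i)⌋) with hcls
  set Q := D.image cls with hQ
  have hchoice : ∀ C ∈ Q, ∃ i ∈ D, cls i = C ∧ ∀ i' ∈ D, cls i' = C → k i' ≤ k i := by
    intro C hC
    obtain ⟨i₀, h1, h2⟩ := Finset.mem_image.1 hC
    obtain ⟨i, hi, hmax⟩ := Finset.exists_max_image (D.filter fun i => cls i = C) k
      ⟨i₀, Finset.mem_filter.2 ⟨h1, h2⟩⟩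
    exact ⟨i, (Finset.mem_filter.1 hi).1, (Finset.mem_filter.1 hi).2,
      fun i' h h' => hmax i' (Finset.mem_filter.2 ⟨h, h'⟩)⟩
  rcases D.eq_empty_or_nonempty with rfl | ⟨i₀, -⟩
  · refine ⟨fun _ => 0, monotone_const, fun _ _ => ?_, by simp⟩
    have := hV 0 0 le_rfl
    simp only [sub_self] at this ⊢
    positivity
  have : Nonempty ι := ⟨i₀⟩
  choose! I hID hIC hImax using hchoice
  choose! σ u v τ m hσ hσu huv hvτ hτ hτσ hmσ hmτ hval using hw
  have hpow : ∀ n : ℤ, (0 : ℝ) < 2 ^ n := fun n => by positivity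
  have hlog : ∀ i ∈ D, (2 : ℝ) ^ (cls i).1 ≤ t i ∧ t i < 2 * 2 ^ (cls i).1 := by
    intro i hi
    refine ⟨by exact_mod_cast Int.zpow_log_le_self (b := 2) (by norm_num) (ht i hi), ?_⟩
    have := Int.lt_zpow_succ_log_self (b := 2) (by norm_num) (t i)
    rw [zpow_add_one₀ (by norm_num)] at this
    push_cast at this
    linarith
  have hloc : ∀ i, ((cls i).2 : ℝ) * 2 ^ (cls i).1 ≤ r i ∧
      r i < ((cls i).2 + 1) * (2 : ℝ) ^ (cls i).1 := by
    intro i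
    exact ⟨(le_div_iff₀ (hpow _)).1 (Int.floor_le _), (div_lt_iff₀ (hpow _)).1 (Int.lt_floor_add_one _)⟩
  have hsum : ∑ C ∈ Q, (2 : ℝ) ^ C.1 * k (I C) / 4 ≤ 4 * 20 * V := by
    refine sum_wells_le Q hg hgi hT hV (by norm_num) (fun C => σ (I C)) (fun C => u (I C))
      (fun C => v (I C)) (fun C => τ (I C)) (fun C => m (I C)) (fun C => 2 ^ C.1) _
      (fun C hC => hσu _ (hID C hC)) (fun C hC => huv _ (hID C hC)) (fun C hC => hvτ _ (hID C hC))
      (fun C hC => hmσ _ (hID C hC)) (fun C hC => hmτ _ (hID C hC)) (fun C _ => hpow _) ?_ ?_ ?_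
    · intro C hC
      have h1 := hlog _ (hID C hC)
      rw [hIC C hC] at h1
      have := hτσ _ (hID C hC)
      linarith
    · intro z l hl
      refine sum_one_div_two_zpow_le (z := z) hl (fun C hC => (Finset.mem_filter.1 hC).2.2.2) ?_
      intro C hC
      obtain ⟨hCQ, h1, h2, -⟩ := Finset.mem_filter.1 hC
      have hi := hID C hCQ
      have h3 := hlog _ hi
      have h4 := hloc (I C)
      rw [hIC C hCQ] at h3 h4
      have h5 := hσ _ hi
      have h6 := hσu _ hi
      have h7 := hvτ _ hi
      have h8 := hτ _ hi
      have h9 : z / 2 ^ C.1 * 2 ^ C.1 = z := div_mul_cancel₀ _ (hpow _).ne'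
      constructor
      · refine lt_of_mul_lt_mul_right ?_ (hpow C.1).le
        nlinarith
      · refine lt_of_mul_lt_mul_right ?_ (hpow C.1).le
        nlinarith
    · intro C hC
      have hi := hID C hC
      refine le_trans ?_ (hval _ hi)
      have h3 := hlog _ hi
      rw [hIC C hC] at h3
      have h0 := hk _ hi
      have h1 : (2 : ℝ) ^ C.1 * 2 ^ C.1 ≤ t (I C) * t (I C) :=
        mul_le_mul h3.1 h3.1 (hpow _).le (ht _ hi).le
      nlinarith
  set K : ℝ → ℝ := fun x => ∑ C ∈ Q, k (I C) *
    max (((C.2 : ℝ) - 1) * 2 ^ C.1) (min x (((C.2 : ℝ) + 2) * 2 ^ C.1)) with hK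
  have hdiff : ∀ x y, K y - K x = ∑ C ∈ Q, k (I C) *
      (max (((C.2 : ℝ) - 1) * 2 ^ C.1) (min y (((C.2 : ℝ) + 2) * 2 ^ C.1)) -
        max (((C.2 : ℝ) - 1) * 2 ^ C.1) (min x (((C.2 : ℝ) + 2) * 2 ^ C.1))) := by
    intro x y
    simp only [hK, mul_sub, Finset.sum_sub_distrib]
  have hnn : ∀ x y, x ≤ y → ∀ C ∈ Q, 0 ≤ k (I C) *
      (max (((C.2 : ℝ) - 1) * 2 ^ C.1) (min y (((C.2 : ℝ) + 2) * 2 ^ C.1)) -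
        max (((C.2 : ℝ) - 1) * 2 ^ C.1) (min x (((C.2 : ℝ) + 2) * 2 ^ C.1))) := by
    intro x y hxy C hC
    refine mul_nonneg (hk _ (hID C hC)) (sub_nonneg.2 ?_)
    gcongr
  refine ⟨K, fun x y hxy => ?_, fun x y => ?_, fun i hi => ?_⟩
  · rw [← sub_nonneg, hdiff]
    exact Finset.sum_nonneg (hnn x y hxy)
  · rw [hdiff]
    calc _ ≤ ∑ C ∈ Q, 12 * ((2 : ℝ) ^ C.1 * k (I C) / 4) := by
          refine Finset.sum_le_sum fun C hC => ?_
          have h0 := hk _ (hID C hC)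
          have h1 : max (((C.2 : ℝ) - 1) * 2 ^ C.1) (min y (((C.2 : ℝ) + 2) * 2 ^ C.1)) ≤
              (C.2 + 2) * 2 ^ C.1 := max_le (by nlinarith [hpow C.1]) (min_le_right _ _)
          have h2 : ((C.2 : ℝ) - 1) * 2 ^ C.1 ≤
              max (((C.2 : ℝ) - 1) * 2 ^ C.1) (min x (((C.2 : ℝ) + 2) * 2 ^ C.1)) := le_max_left _ _
          calc _ ≤ k (I C) * (3 * 2 ^ C.1) := mul_le_mul_of_nonneg_left (by linarith) h0
            _ = _ := by ring
      _ ≤ _ := by rw [← Finset.mul_sum]; linarith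
  · have hC : cls i ∈ Q := Finset.mem_image_of_mem _ hi
    refine ⟨k (I (cls i)), hImax _ hC i hi rfl, fun x y hx hxy hy => ?_⟩
    rw [hdiff]
    refine le_trans (le_of_eq ?_) (Finset.single_le_sum (hnn x y hxy) hC)
    obtain ⟨h1, h2⟩ := hlog i hi
    obtain ⟨h3, h4⟩ := hloc i
    have h5 := hpow (cls i).1
    have h6 : ∀ w, x ≤ w → w ≤ y → max (((cls i).2 - 1 : ℝ) * 2 ^ (cls i).1)
        (min w (((cls i).2 + 2) * 2 ^ (cls i).1)) = w := by
      intro w h7 h8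
      rw [min_eq_left (by nlinarith), max_eq_right (by nlinarith)]
    rw [h6 x le_rfl hxy, h6 y hxy le_rfl]

theorem exists_monotone_dense_slope {α : ℝ} (h0 : 0 ≤ α) (h1 : α ≤ 1) {g M N T : ℝ → ℝ} {V : ℝ}
    (hg : Measurable g) (hgi : ∀ a b, IntervalIntegrable g volume a b)
    (hT : ∀ x y, x ≤ y → |g y - g x| ≤ T y - T x) (hV : ∀ x y, x ≤ y → T y - T x ≤ V)
    (hM : ∀ z y t, 0 < t → t ≤ N z → |z - y| ≤ α * t →
      ∫ w in (y - t)..(y + t), g w ≤ 2 * t * M z)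
    (hN : ∀ x y, N x - N y ≤ |x - y| / (1 + α)) (X : Finset ℝ) (c t A : ℝ → ℝ)
    (ht : ∀ r ∈ X, 0 < t r) (htN : ∀ r ∈ X, t r ≤ N r) (hrc : ∀ r ∈ X, |r - c r| ≤ α * t r)
    (hA : ∀ r ∈ X, ∫ z in (c r - t r)..(c r + t r), g z = 2 * t r * A r) :
    ∃ K : ℝ → ℝ, Monotone K ∧ (∀ x y, K y - K x ≤ 960 * V) ∧
      ∀ p ∈ X, ∀ r ∈ X, ∀ q ∈ X, p < r → r < q → r - p ≤ t r / 8 → q - r ≤ t r / 8 →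
        M p ≤ A r → M q ≤ A r → K r - K p < A r - M p → A r - M q ≤ K q - K r := by
  classical
  set D := (X ×ˢ X ×ˢ X).filter fun i => i.1 < i.2.1 ∧ i.2.1 < i.2.2 ∧
    i.2.1 - i.1 ≤ t i.2.1 / 8 ∧ i.2.2 - i.2.1 ≤ t i.2.1 / 8 ∧ M i.1 ≤ A i.2.1 ∧ M i.2.2 ≤ A i.2.1
    with hD
  set k : ℝ × ℝ × ℝ → ℝ := fun i =>
    min ((A i.2.1 - M i.1) / (i.2.1 - i.1)) ((A i.2.1 - M i.2.2) / (i.2.2 - i.2.1)) with hk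
  have hDX : ∀ i ∈ D, i.2.1 ∈ X := fun i hi =>
    (Finset.mem_product.1 (Finset.mem_product.1 (Finset.mem_filter.1 hi).1).2).1
  have hk0 : ∀ i ∈ D, 0 ≤ k i := by
    intro i hi
    obtain ⟨-, a1, a2, -, -, a5, a6⟩ := Finset.mem_filter.1 hi
    exact le_min (div_nonneg (by linarith) (by linarith)) (div_nonneg (by linarith) (by linarith))
  obtain ⟨K, hK1, hK2, hK3⟩ := exists_monotone_slope D hg hgi hT hV (fun i => i.2.1)
    (fun i => t i.2.1) k (fun i hi => ht _ (hDX i hi)) hk0 (by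
      intro i hi
      have hX := hDX i hi
      obtain ⟨-, a1, a2, a3, a4, a5, a6⟩ := Finset.mem_filter.1 hi
      obtain ⟨σ, u, v, τ, b1, b2, b3, b4, b5, b6, b7, b8⟩ :=
        exists_well_of_dense h0 h1 hgi hM hN (ht _ hX) (htN _ hX) (hrc _ hX) (hA _ hX) a1 a2 a3 a4
          (hk0 i hi) ((le_div_iff₀ (sub_pos.2 a1)).1 (min_le_left _ _))
          ((le_div_iff₀ (sub_pos.2 a2)).1 (min_le_right _ _))
      have e1 := abs_le.1 (hrc _ hX)
      have e2 : α * t i.2.1 ≤ t i.2.1 := by nlinarith [ht _ hX]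
      exact ⟨σ, u, v, τ, _, by linarith, b2, b3, b4, by linarith, by linarith, b6, b7, b8⟩)
  refine ⟨K, hK1, hK2, ?_⟩
  intro p hp r hr q hq hpr hrq hp8 hq8 hMp hMq hKp
  have hmem : (p, r, q) ∈ D := Finset.mem_filter.2
    ⟨Finset.mem_product.2 ⟨hp, Finset.mem_product.2 ⟨hr, hq⟩⟩, hpr, hrq, hp8, hq8, hMp, hMq⟩
  obtain ⟨κ, e1, e2⟩ := hK3 _ hmem
  have e3 := e2 p r (by simp only; linarith) hpr.le (by simp only; linarith [ht r hr])
  have e4 := e2 r q (by simp only; linarith [ht r hr]) hrq.le (by simp only; linarith)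
  rcases min_le_iff.1 e1 with h | h
  · have := (div_le_iff₀ (sub_pos.2 hpr)).1 h
    simp only at this
    linarith
  · have := (div_le_iff₀ (sub_pos.2 hrq)).1 h
    simp only at this
    linarith

/-- A sparse peak `p < r < q` of the maximal function is either paid for by the variation of `g`
on `[p, w]`, or is a well of `g` inside the interval seen by `r`. -/
theorem variation_or_well_of_sparse {α : ℝ} (h0 : 0 ≤ α) (h1 : α ≤ 1) {g M N T : ℝ → ℝ}
    (hgi : ∀ a b, IntervalIntegrable g volume a b)
    (hT : ∀ x y, x ≤ y → |g y - g x| ≤ T y - T x)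
    (hM : ∀ z y t, 0 < t → t ≤ N z → |z - y| ≤ α * t →
      ∫ w in (y - t)..(y + t), g w ≤ 2 * t * M z)
    (hN0 : ∀ x, 0 < N x)
    (hN : ∀ x y, N x - N y ≤ |x - y| / (1 + α)) {p r q w c t A : ℝ}
    (ht : 0 < t) (htN : t ≤ N r) (hrc : |r - c| ≤ α * t)
    (hA : ∫ z in (c - t)..(c + t), g z = 2 * t * A)
    (hpr : p < r) (hrq : r < q) (hqw : q < w) (hpq : t / 8 ≤ q - p) (hMp : M p < A) (hMq : M q < A) :
    3 / 4 * (A - M q) ≤ T w - T p ∨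
      ∃ σ τ, σ ≤ p ∧ q ≤ τ ∧ A ≤ g σ ∧ A ≤ g τ ∧ τ - σ ≤ 2 * t ∧
        (A - M q) / 32 * t ≤ ∫ z in p..q, (A - g z) := by
  have hTm : Monotone T := fun x y h => by linarith [hT x y h, abs_nonneg (g y - g x)]
  obtain ⟨hx1, hx2⟩ := abs_le.1 hrc
  have h1α : 0 < 1 + α := by linarith
  by_cases hz : ∃ z, p < z ∧ z < q ∧ A - (A - M q) / 4 < g z
  · left
    obtain ⟨z, hpz, hzq, hgz⟩ := hz
    set ρ := min (N q) (min (w - q) (q - z)) with hρ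
    have hρ0 : 0 < ρ := lt_min (hN0 q) (lt_min (by linarith) (by linarith))
    have hρ1 : ρ ≤ N q := min_le_left _ _
    have hρ2 : ρ ≤ w - q := (min_le_right _ _).trans (min_le_left _ _)
    have hρ3 : ρ ≤ q - z := (min_le_right _ _).trans (min_le_right _ _)
    have hav := hM q q ρ hρ0 hρ1 (by rw [sub_self, abs_zero]; positivity)
    obtain ⟨z', a1, a2, a3⟩ := exists_le_of_mul_le_integral (g := fun x => -g x)
      (fun a b => (hgi a b).neg) (a := q - ρ) (b := q + ρ) (K := -M q) (by linarith) (by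
        rw [intervalIntegral.integral_neg]; linarith)
    have e1 := (abs_le.1 (hT z z' (by linarith))).1
    have e2 : T z' ≤ T w := hTm (by linarith)
    have e3 : T p ≤ T z := hTm hpz.le
    linarith
  right
  push Not at hz
  have hD : 0 < A - M q := by linarith
  have hout : ∀ z, A ≤ g z → z ≤ p ∨ q ≤ z := by
    intro z hgz
    by_contra! hcon
    linarith [hz z hcon.1 hcon.2]
  have hσ : ∃ σ, c - t ≤ σ ∧ σ ≤ p ∧ A ≤ g σ := by
    suffices ∃ b, b ≤ q ∧ ∃ z, c - t < z ∧ z < b ∧ A ≤ g z by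
      obtain ⟨b, hb, z, k1, k2, k3⟩ := this
      refine ⟨z, k1.le, ?_, k3⟩
      rcases hout z k3 with h | h
      · exact h
      · linarith
    rcases le_or_gt (c + t) q with hq | hq
    · exact ⟨c + t, hq, exists_le_of_mul_le_integral hgi (by linarith) (by rw [hA]; linarith)⟩
    · have e : (c + t - q) / (1 + α) * (1 + α) = c + t - q := by field_simp
      have hNq := hN r q
      rw [abs_of_neg (by linarith), neg_sub] at hNq
      have e' : (q - r) / (1 + α) * (1 + α) = q - r := by field_simp
      set ρ := (c + t - q) / (1 + α)
      set η := (q - r) / (1 + α)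
      have hη0 : 0 < η := by nlinarith
      have hρ0 : 0 < ρ := by nlinarith
      have hρη : ρ + η ≤ t := le_of_mul_le_mul_right (by linarith) h1α
      have hav := hM q (c + t - ρ) ρ hρ0 (by linarith)
        (by rw [show q - (c + t - ρ) = -(α * ρ) by linarith, abs_neg,
          abs_of_nonneg (by positivity)])
      rw [show c + t - ρ - ρ = c + t - 2 * ρ by ring, sub_add_cancel] at hav
      have hadd := intervalIntegral.integral_add_adjacent_intervals
        (hgi (c - t) (c + t - 2 * ρ)) (hgi (c + t - 2 * ρ) (c + t))
      refine ⟨c + t - 2 * ρ, by nlinarith, exists_le_of_mul_le_integral hgi (by linarith) ?_⟩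
      nlinarith
  have hτ : ∃ τ, q ≤ τ ∧ τ ≤ c + t ∧ A ≤ g τ := by
    suffices ∃ a, p ≤ a ∧ ∃ z, a < z ∧ z < c + t ∧ A ≤ g z by
      obtain ⟨b, hb, z, k1, k2, k3⟩ := this
      refine ⟨z, ?_, k2.le, k3⟩
      rcases hout z k3 with h | h
      · linarith
      · exact h
    rcases le_or_gt p (c - t) with hp | hp
    · exact ⟨c - t, hp, exists_le_of_mul_le_integral hgi (by linarith) (by rw [hA]; linarith)⟩
    · have e : (p - (c - t)) / (1 + α) * (1 + α) = p - (c - t) := by field_simp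
      have hNp := hN r p
      rw [abs_of_pos (by linarith)] at hNp
      have e' : (r - p) / (1 + α) * (1 + α) = r - p := by field_simp
      set ρ := (p - (c - t)) / (1 + α)
      set η := (r - p) / (1 + α)
      have hη0 : 0 < η := by nlinarith
      have hρ0 : 0 < ρ := by nlinarith
      have hρη : ρ + η ≤ t := le_of_mul_le_mul_right (by linarith) h1α
      have hav := hM p (c - t + ρ) ρ hρ0 (by linarith)
        (by rw [show p - (c - t + ρ) = α * ρ by linarith, abs_of_nonneg (by positivity)])
      rw [show c - t + ρ + ρ = c - t + 2 * ρ by ring, add_sub_cancel_right] at hav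
      have hadd := intervalIntegral.integral_add_adjacent_intervals
        (hgi (c - t) (c - t + 2 * ρ)) (hgi (c - t + 2 * ρ) (c + t))
      refine ⟨c - t + 2 * ρ, by nlinarith, exists_le_of_mul_le_integral hgi (by linarith) ?_⟩
      nlinarith
  obtain ⟨σ, a1, a2, a3⟩ := hσ
  obtain ⟨τ, b1, b2, b3⟩ := hτ
  refine ⟨σ, τ, a2, b1, a3, b3, by linarith, ?_⟩
  calc (A - M q) / 32 * t ≤ (q - p) * ((A - M q) / 4) := by nlinarith
    _ = ∫ _ in p..q, (A - M q) / 4 := by rw [intervalIntegral.integral_const, smul_eq_mul]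
    _ ≤ _ := by
      refine intervalIntegral.integral_mono_on_of_le_Ioo (by linarith) intervalIntegrable_const
        (intervalIntegrable_const.sub (hgi _ _)) fun z hz' => ?_
      linarith [hz z hz'.1 hz'.2]

theorem sum_peaks_le {α : ℝ} (h0 : 0 ≤ α) (h1 : α ≤ 1) {g M N T K : ℝ → ℝ} {V : ℝ}
    (hg : Measurable g) (hgi : ∀ a b, IntervalIntegrable g volume a b)
    (hT : ∀ x y, x ≤ y → |g y - g x| ≤ T y - T x) (hV : ∀ x y, x ≤ y → T y - T x ≤ V)
    (hM : ∀ z y t, 0 < t → t ≤ N z → |z - y| ≤ α * t →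
      ∫ w in (y - t)..(y + t), g w ≤ 2 * t * M z)
    (hN0 : ∀ x, 0 < N x)
    (hN : ∀ x y, N x - N y ≤ |x - y| / (1 + α)) (X : Finset ℝ) (c t A : ℝ → ℝ)
    (ht : ∀ r ∈ X, 0 < t r) (htN : ∀ r ∈ X, t r ≤ N r) (hrc : ∀ r ∈ X, |r - c r| ≤ α * t r)
    (hA : ∀ r ∈ X, ∫ z in (c r - t r)..(c r + t r), g z = 2 * t r * A r)
    (hsel : ∀ r ∈ X, ∀ z ∈ X, M z < M r → M r + M z ≤ 2 * A r)
    (hK : Monotone K) (hKV : ∀ x y, K y - K x ≤ 960 * V)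
    (hdense : ∀ p ∈ X, ∀ r ∈ X, ∀ q ∈ X, p < r → r < q → r - p ≤ t r / 8 → q - r ≤ t r / 8 →
      M p ≤ A r → M q ≤ A r → K r - K p < A r - M p → A r - M q ≤ K q - K r)
    (m : ℕ) (y : ℕ → ℝ) (hy : ∀ i j, i < j → j ≤ m + 2 → y i < y j) (hyX : ∀ i ≤ m + 2, y i ∈ X) :
    ∑ j ∈ Finset.range m with (M (y j) - 2 * K (y j) < M (y (j + 1)) - 2 * K (y (j + 1)) ∧
        M (y (j + 2)) - 2 * K (y (j + 2)) < M (y (j + 1)) - 2 * K (y (j + 1))),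
      ((M (y (j + 1)) - 2 * K (y (j + 1))) - (M (y (j + 2)) - 2 * K (y (j + 2)))) ≤ 4104 * V := by
  classical
  have hTm : Monotone T := fun x y h => by linarith [hT x y h, abs_nonneg (g y - g x)]
  set s := (Finset.range m).filter fun j =>
    M (y j) - 2 * K (y j) < M (y (j + 1)) - 2 * K (y (j + 1)) ∧
      M (y (j + 2)) - 2 * K (y (j + 2)) < M (y (j + 1)) - 2 * K (y (j + 1)) with hs
  set E := s.filter fun j => M (y (j + 2)) < A (y (j + 1)) ∧ ∃ σ τ, σ ≤ y j ∧ y (j + 2) ≤ τ ∧ A (y (j + 1)) ≤ g σ ∧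
    A (y (j + 1)) ≤ g τ ∧ τ - σ ≤ 2 * t (y (j + 1)) ∧
    (A (y (j + 1)) - M (y (j + 2))) / 32 * t (y (j + 1)) ≤
      ∫ z in (y j)..(y (j + 2)), (A (y (j + 1)) - g z) with hE
  have hV0 : 0 ≤ V := by simpa using hV 0 0 le_rfl
  have hmem : ∀ j ∈ s, j < m := fun j hj => Finset.mem_range.1 (Finset.mem_filter.1 hj).1
  have hpt : ∀ j ∈ s, (M (y (j + 1)) - 2 * K (y (j + 1))) - (M (y (j + 2)) - 2 * K (y (j + 2))) ≤
      4 * (K (y (j + 2)) - K (y (j + 1))) + 8 / 3 * (T (y (j + 3)) - T (y j)) +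
        if j ∈ E then 2 * (A (y (j + 1)) - M (y (j + 2))) else 0 := by
    intro j hj
    have hjm := hmem j hj
    obtain ⟨-, hpk, hqk⟩ := Finset.mem_filter.1 hj
    have hp := hyX j (by omega)
    have hr := hyX (j + 1) (by omega)
    have hq := hyX (j + 2) (by omega)
    have hpr := hy j (j + 1) (by omega) (by omega)
    have hrq := hy (j + 1) (j + 2) (by omega) (by omega)
    have hqw := hy (j + 2) (j + 3) (by omega) (by omega)
    have hKpr := hK hpr.le
    have hKrq := hK hrq.le
    have hTpw := hTm (hpr.trans (hrq.trans hqw)).le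
    have hif : (0 : ℝ) ≤ if j ∈ E then 2 * (A (y (j + 1)) - M (y (j + 2))) else 0 := by
      split_ifs with h
      · have := (Finset.mem_filter.1 h).2.1
        linarith
      · exact le_rfl
    rcases le_or_gt (M (y (j + 1))) (M (y (j + 2))) with hMqr | hMqr
    · linarith
    have hsp := hsel _ hr _ hp (by linarith)
    have hsq := hsel _ hr _ hq hMqr
    by_cases hd : y (j + 1) - y j ≤ t (y (j + 1)) / 8 ∧ y (j + 2) - y (j + 1) ≤ t (y (j + 1)) / 8
    · have := hdense _ hp _ hr _ hq hpr hrq hd.1 hd.2 (by linarith) (by linarith) (by linarith)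
      linarith
    have hpq : t (y (j + 1)) / 8 ≤ y (j + 2) - y j := by
      by_contra! hcon
      exact hd ⟨by linarith, by linarith⟩
    rcases variation_or_well_of_sparse h0 h1 hgi hT hM hN0 hN (ht _ hr) (htN _ hr) (hrc _ hr)
      (hA _ hr) hpr hrq hqw hpq (by linarith) (by linarith) with h | h
    · linarith
    · rw [if_pos (Finset.mem_filter.2 ⟨hj, by linarith, h⟩)]
      linarith
  have hEsum : ∑ j ∈ E, (A (y (j + 1)) - M (y (j + 2))) / 32 ≤ 4 * 1 * V := by
    have hex : ∀ j ∈ E, ∃ σ τ, σ ≤ y j ∧ y (j + 2) ≤ τ ∧ A (y (j + 1)) ≤ g σ ∧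
      A (y (j + 1)) ≤ g τ ∧ τ - σ ≤ 2 * t (y (j + 1)) ∧
      (A (y (j + 1)) - M (y (j + 2))) / 32 * t (y (j + 1)) ≤
        ∫ z in (y j)..(y (j + 2)), (A (y (j + 1)) - g z) := fun j hj => (Finset.mem_filter.1 hj).2.2
    choose! σ τ a1 a2 a3 a4 a5 a6 using hex
    have hEm : ∀ j ∈ E, j < m := fun j hj => hmem j (Finset.mem_filter.1 hj).1
    have hEX : ∀ j ∈ E, y (j + 1) ∈ X := fun j hj => hyX _ (by have := hEm j hj; omega)
    refine sum_wells_le E hg hgi hT hV zero_le_one σ (fun j => y j) (fun j => y (j + 2)) τ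
      (fun j => A (y (j + 1))) (fun j => t (y (j + 1))) _ a1
      (fun j hj => hy _ _ (by omega) (by have := hEm j hj; omega)) a2 a3 a4
      (fun j hj => ht _ (hEX j hj))
      (fun j hj => by have := a5 j hj; have := ht _ (hEX j hj); linarith) ?_ a6
    intro z l hl
    set F := E.filter fun j => y j < z ∧ z ≤ y (j + 2) ∧ l ≤ t (y (j + 1)) with hF
    have hlt : ∀ i ∈ F, ∀ j ∈ F, ¬ i < j := by
      intro i hi j hj hij
      obtain ⟨hiE, i1, i2, -⟩ := Finset.mem_filter.1 hi
      obtain ⟨hjE, j1, j2, -⟩ := Finset.mem_filter.1 hj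
      have hjm := hEm j hjE
      obtain ⟨-, i3, i4⟩ := Finset.mem_filter.1 (Finset.mem_filter.1 hiE).1
      obtain ⟨-, j3, j4⟩ := Finset.mem_filter.1 (Finset.mem_filter.1 hjE).1
      rcases (show j = i + 1 ∨ i + 2 = j ∨ i + 2 < j by omega) with rfl | rfl | h
      · exact lt_asymm i4 j3
      · linarith
      · linarith [hy _ _ h (by omega)]
    have hcard : F.card ≤ 1 := Finset.card_le_one.2 fun i hi j hj =>
      le_antisymm (not_lt.1 (hlt j hj i hi)) (not_lt.1 (hlt i hi j hj))
    calc ∑ j ∈ F, 1 / t (y (j + 1)) ≤ ∑ j ∈ F, 1 / l := by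
          refine Finset.sum_le_sum fun j hj => ?_
          exact one_div_le_one_div_of_le hl (Finset.mem_filter.1 hj).2.2.2
      _ = F.card * (1 / l) := by rw [Finset.sum_const, nsmul_eq_mul]
      _ ≤ 1 * (1 / l) := by gcongr; exact_mod_cast hcard
      _ = 1 / l := one_mul _
  have hyle : ∀ i j, i ≤ j → j ≤ m + 2 → y i ≤ y j := by
    intro i j hij hj
    rcases hij.eq_or_lt with rfl | h
    · exact le_rfl
    · exact (hy _ _ h hj).le
  have htele : ∀ (f : ℝ → ℝ) (a : ℕ), ∑ j ∈ Finset.range m, (f (y (j + (a + 1))) - f (y (j + a))) =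
      f (y (m + a)) - f (y a) := by
    intro f a
    have := Finset.sum_range_sub (fun j => f (y (j + a))) m
    simp only [zero_add] at this
    rw [← this]
    refine Finset.sum_congr rfl fun j _ => ?_
    rw [show j + (a + 1) = j + 1 + a by ring]
  calc _ ≤ ∑ j ∈ s, (4 * (K (y (j + 2)) - K (y (j + 1))) + 8 / 3 * (T (y (j + 3)) - T (y j)) +
        if j ∈ E then 2 * (A (y (j + 1)) - M (y (j + 2))) else 0) := Finset.sum_le_sum hpt
    _ = ∑ j ∈ s, (4 * (K (y (j + 2)) - K (y (j + 1))) + 8 / 3 * (T (y (j + 3)) - T (y j))) +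
        ∑ j ∈ E, 2 * (A (y (j + 1)) - M (y (j + 2))) := by
      rw [Finset.sum_add_distrib, Finset.sum_ite_mem,
        Finset.inter_eq_right.2 (Finset.filter_subset _ _)]
    _ ≤ ∑ j ∈ Finset.range m,
          (4 * (K (y (j + 2)) - K (y (j + 1))) + 8 / 3 * (T (y (j + 3)) - T (y j))) +
        64 * ∑ j ∈ E, (A (y (j + 1)) - M (y (j + 2))) / 32 := by
      refine add_le_add (Finset.sum_le_sum_of_subset_of_nonneg (Finset.filter_subset _ _) ?_) ?_
      · intro j hj _
        have hj := Finset.mem_range.1 hj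
        have e1 := hK (hyle (j + 1) (j + 2) (by omega) (by omega))
        have e2 := hTm (hyle j (j + 3) (by omega) (by omega))
        linarith
      · rw [Finset.mul_sum]
        exact Finset.sum_le_sum fun j _ => by linarith
    _ = 4 * (K (y (m + 1)) - K (y 1)) + 8 / 3 * ((T (y (m + 2)) - T (y 2)) +
          (T (y (m + 1)) - T (y 1)) + (T (y m) - T (y 0))) +
        64 * ∑ j ∈ E, (A (y (j + 1)) - M (y (j + 2))) / 32 := by
      rw [← htele K 1, ← htele T 2, ← htele T 1,
        show T (y m) - T (y 0) = ∑ j ∈ Finset.range m, (T (y (j + 1)) - T (y j)) by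
          simpa using (htele T 0).symm,
        ← Finset.sum_add_distrib, ← Finset.sum_add_distrib, Finset.mul_sum _ _ (4 : ℝ),
        Finset.mul_sum _ _ (8 / 3 : ℝ),
        ← Finset.sum_add_distrib]
      congr 1
      refine Finset.sum_congr rfl fun j _ => ?_
      norm_num
    _ ≤ 4104 * V := by
      have e1 := hKV (y 1) (y (m + 1))
      have e2 := hV _ _ (hyle 2 (m + 2) (by omega) le_rfl)
      have e3 := hV _ _ (hyle 1 (m + 1) (by omega) (by omega))
      have e4 := hV _ _ (hyle 0 m (by omega) (by omega))
      linarith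

/-- The variation of a bounded function along sequences is controlled by the sums of its falls
at strict peaks. -/
theorem sum_abs_sub_le_of_peaks {G : ℝ → ℝ} {X : Finset ℝ} {B O : ℝ}
    (hO : ∀ x ∈ X, ∀ y ∈ X, |G x - G y| ≤ O)
    (hpk : ∀ (m : ℕ) (y : ℕ → ℝ), (∀ i j, i < j → j ≤ m + 2 → y i < y j) →
      (∀ i ≤ m + 2, y i ∈ X) →
      ∑ j ∈ Finset.range m with (G (y j) < G (y (j + 1)) ∧ G (y (j + 2)) < G (y (j + 1))),
        (G (y (j + 1)) - G (y (j + 2))) ≤ B) (hB : 0 ≤ B) (n : ℕ) :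
    ∀ y : ℕ → ℝ, (∀ i j, i ≤ j → j ≤ n → y i ≤ y j) → (∀ i ≤ n, y i ∈ X) →
      ∑ i ∈ Finset.range n, |G (y (i + 1)) - G (y i)| ≤ 2 * B + 5 * O := by
  induction n with
  | zero =>
    intro y _ hX
    have := (abs_nonneg _).trans (hO _ (hX 0 le_rfl) _ (hX 0 le_rfl))
    simp only [Finset.range_zero, Finset.sum_empty]
    positivity
  | succ n ih =>
    intro y hy hX
    have hO0 := (abs_nonneg _).trans (hO _ (hX 0 (by omega)) _ (hX 0 (by omega)))
    by_cases hrem : ∃ i, i + 2 ≤ n + 1 ∧ |G (y (i + 1)) - G (y i)| + |G (y (i + 2)) - G (y (i + 1))|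
        = |G (y (i + 2)) - G (y i)|
    · obtain ⟨i, hi, heq⟩ := hrem
      obtain ⟨k, rfl⟩ : ∃ k, n = i + 1 + k := ⟨n - (i + 1), by omega⟩
      set y' : ℕ → ℝ := fun j => if j ≤ i then y j else y (j + 1) with hy'
      have hlow : ∀ j ≤ i, y' j = y j := fun j hj => if_pos hj
      have hhigh : ∀ j, i < j → y' j = y (j + 1) := fun j hj => if_neg (not_le.2 hj)
      have key := ih y' (by
        intro a b hab hb
        simp only [hy']
        split_ifs <;> exact hy _ _ (by omega) (by omega)) (by
        intro j hj
        simp only [hy']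
        split_ifs <;> exact hX _ (by omega))
      refine le_trans (le_of_eq ?_) key
      rw [show i + 1 + k + 1 = i + 2 + k by ring, Finset.sum_range_add _ (i + 2) k,
        Finset.sum_range_add _ (i + 1) k,
        Finset.sum_range_succ, Finset.sum_range_succ, Finset.sum_range_succ]
      congr 1
      · rw [add_assoc, heq, hlow i le_rfl, hhigh (i + 1) (by omega)]
        congr 1
        refine Finset.sum_congr rfl fun j hj => ?_
        have := Finset.mem_range.1 hj
        rw [hlow j (by omega), hlow (j + 1) (by omega)]
      · refine Finset.sum_congr rfl fun j _ => ?_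
        rw [hhigh (i + 1 + j) (by omega), hhigh (i + 1 + j + 1) (by omega),
          show i + 1 + j + 1 = i + 2 + j by ring]
    · push Not at hrem
      have halt : ∀ i, i + 2 ≤ n + 1 → G (y i) < G (y (i + 1)) ∧ G (y (i + 2)) < G (y (i + 1)) ∨
          G (y (i + 1)) < G (y i) ∧ G (y (i + 1)) < G (y (i + 2)) := by
        intro i hi
        by_contra! hcon
        apply hrem i hi
        rcases le_total (G (y i)) (G (y (i + 1))) with h1 | h1 <;>
          rcases le_total (G (y (i + 1))) (G (y (i + 2))) with h2 | h2
        · rw [abs_of_nonneg (by linarith), abs_of_nonneg (by linarith),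
            abs_of_nonneg (by linarith)]; ring
        · rcases h1.eq_or_lt with h | h
          · rw [h]; simp
          · have : G (y (i + 1)) = G (y (i + 2)) := le_antisymm (hcon.1 h) h2
            rw [← this]; simp
        · rcases h1.eq_or_lt with h | h
          · rw [h]; simp
          · have : G (y (i + 1)) = G (y (i + 2)) := le_antisymm h2 (hcon.2 h)
            rw [← this]; simp
        · rw [abs_of_nonpos (by linarith), abs_of_nonpos (by linarith),
            abs_of_nonpos (by linarith)]; ring
      rcases n with _ | m
      · have := hO _ (hX 1 le_rfl) _ (hX 0 (by omega))
        simp only [zero_add, Finset.sum_range_one]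
        linarith
      have hne : ∀ i, i < m + 2 → G (y i) ≠ G (y (i + 1)) := by
        intro i hi
        rcases Nat.lt_or_ge i (m + 1) with h | h
        · rcases halt i (by omega) with h' | h'
          · exact h'.1.ne
          · exact h'.1.ne'
        · obtain rfl : i = m + 1 := by omega
          rcases halt m (by omega) with h' | h'
          · exact h'.2.ne'
          · exact h'.2.ne
      have hstep : ∀ i, i < m + 2 → y i < y (i + 1) := fun i hi =>
        lt_of_le_of_ne (hy _ _ (by omega) (by omega)) fun h => hne i hi (by rw [← h])
      have hstrict : ∀ i j, i < j → j ≤ m + 2 → y i < y j := fun i j hij hj =>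
        (hstep i (by omega)).trans_le (hy _ _ (by omega) (by omega))
      have hpeak := hpk m y hstrict hX
      have hmid : ∑ j ∈ Finset.range m, max (G (y (j + 1)) - G (y (j + 2))) 0 ≤ B := by
        refine le_trans (le_of_eq ?_) hpeak
        rw [Finset.sum_filter]
        refine Finset.sum_congr rfl fun j hj => ?_
        have hj := Finset.mem_range.1 hj
        rcases halt j (by omega) with h | h
        · rw [if_pos h, max_eq_left (by linarith [h.2])]
        · rw [if_neg (fun h' => lt_asymm h.1 h'.1), max_eq_right (by linarith [h.2])]
      have habs : ∀ i, |G (y (i + 1)) - G (y i)| =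
          (G (y (i + 1)) - G (y i)) + 2 * max (G (y i) - G (y (i + 1))) 0 := by
        intro i
        rcases le_total (G (y i)) (G (y (i + 1))) with h | h
        · rw [abs_of_nonneg (by linarith), max_eq_right (by linarith)]; ring
        · rw [abs_of_nonpos (by linarith), max_eq_left (by linarith)]; ring
      have hneg : ∀ i, i < m + 2 → max (G (y i) - G (y (i + 1))) 0 ≤ O := fun i hi =>
        max_le ((le_abs_self _).trans (hO _ (hX i (by omega)) _ (hX (i + 1) (by omega)))) hO0
      simp only [habs, Finset.sum_add_distrib]
      rw [← Finset.mul_sum, Finset.sum_range_sub (fun i => G (y i)), Finset.sum_range_succ,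
        Finset.sum_range_succ']
      have e1 := (le_abs_self _).trans (hO _ (hX (m + 1 + 1) le_rfl) _ (hX 0 (by omega)))
      have e2 := hneg 0 (by omega)
      have e3 := hneg (m + 1) (by omega)
      have e4 : ∑ k ∈ Finset.range m, max (G (y (k + 1)) - G (y (k + 1 + 1))) 0 ≤ B := hmid
      simp only [zero_add] at *
      linarith

theorem sum_abs_sub_le_of_isMaximal {α : ℝ} (h0 : 0 ≤ α) (h1 : α ≤ 1) {g M N T : ℝ → ℝ} {V : ℝ}
    (hg : Measurable g) (hgi : ∀ a b, IntervalIntegrable g volume a b)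
    (hT : ∀ x y, x ≤ y → |g y - g x| ≤ T y - T x) (hV : ∀ x y, x ≤ y → T y - T x ≤ V)
    (hM : ∀ z y t, 0 < t → t ≤ N z → |z - y| ≤ α * t →
      ∫ w in (y - t)..(y + t), g w ≤ 2 * t * M z)
    (hMsup : ∀ z b, b < M z → ∃ y t, 0 < t ∧ t ≤ N z ∧ |z - y| ≤ α * t ∧
      2 * t * b ≤ ∫ w in (y - t)..(y + t), g w)
    (hosc : ∀ x y, |M x - M y| ≤ V) (hN0 : ∀ x, 0 < N x)
    (hN : ∀ x y, N x - N y ≤ |x - y| / (1 + α)) (n : ℕ) (y : ℕ → ℝ) (hy : Monotone y) :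
    ∑ i ∈ Finset.range n, |M (y (i + 1)) - M (y i)| ≤ 19733 * V := by
  classical
  have hV0 : 0 ≤ V := by simpa using hV 0 0 le_rfl
  set X : Finset ℝ := (Finset.range (n + 1)).image y with hX
  have hsel : ∀ r ∈ X, ∃ c t A, 0 < t ∧ t ≤ N r ∧ |r - c| ≤ α * t ∧
      (∫ z in (c - t)..(c + t), g z = 2 * t * A) ∧
      ∀ z ∈ X, M z < M r → M r + M z ≤ 2 * A := by
    intro r _
    obtain ⟨b, hb, hbX⟩ : ∃ b, b < M r ∧ ∀ z ∈ X, M z < M r → M r + M z ≤ 2 * b := by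
      rcases (X.filter fun z => M z < M r).eq_empty_or_nonempty with h | h
      · refine ⟨M r - 1, by linarith, fun z hz hzr => ?_⟩
        have : z ∈ X.filter fun z => M z < M r := Finset.mem_filter.2 ⟨hz, hzr⟩
        rw [h] at this
        exact absurd this (Finset.notMem_empty _)
      · obtain ⟨z₀, hz₀, hmax⟩ := Finset.exists_max_image _ M h
        have := (Finset.mem_filter.1 hz₀).2
        refine ⟨(M r + M z₀) / 2, by linarith, fun z hz hzr => ?_⟩
        have := hmax z (Finset.mem_filter.2 ⟨hz, hzr⟩)
        linarith
    obtain ⟨c, t, ht, htN, hrc, hint⟩ := hMsup r b hb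
    refine ⟨c, t, (∫ z in (c - t)..(c + t), g z) / (2 * t), ht, htN, hrc, by field_simp, ?_⟩
    intro z hz hzr
    have h2 : b ≤ (∫ z in (c - t)..(c + t), g z) / (2 * t) := by
      rw [le_div_iff₀ (by positivity)]; linarith
    linarith [hbX z hz hzr]
  choose! c t A ht htN hrc hA hsel using hsel
  obtain ⟨K, hK, hKV, hdense⟩ :=
    exists_monotone_dense_slope h0 h1 hg hgi hT hV hM hN X c t A ht htN hrc hA
  have hKabs : ∀ x y, |K x - K y| ≤ 960 * V := fun x y =>
    abs_le.2 ⟨by linarith [hKV x y], hKV y x⟩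
  have hsum := sum_abs_sub_le_of_peaks (G := fun x => M x - 2 * K x) (X := X) (B := 4104 * V)
    (O := 1921 * V) (fun x _ y _ => by
      have e1 := abs_le.1 (hosc x y)
      have e2 := abs_le.1 (hKabs x y)
      exact abs_le.2 ⟨by linarith, by linarith⟩)
    (fun m y hy hyX => sum_peaks_le h0 h1 hg hgi hT hV hM hN0 hN X c t A ht htN hrc hA hsel hK hKV
      hdense m y hy hyX)
    (by positivity) n y (fun i j hij _ => hy hij)
    (fun i hi => Finset.mem_image_of_mem _ (Finset.mem_range.2 (by omega)))
  have htele := Finset.sum_range_sub (fun i => K (y i)) n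
  calc ∑ i ∈ Finset.range n, |M (y (i + 1)) - M (y i)|
      ≤ ∑ i ∈ Finset.range n, (|(M (y (i + 1)) - 2 * K (y (i + 1))) - (M (y i) - 2 * K (y i))| +
          2 * (K (y (i + 1)) - K (y i))) := by
        refine Finset.sum_le_sum fun i _ => ?_
        have e1 := hK (hy (Nat.le_succ i))
        simp only [Nat.succ_eq_add_one] at e1
        have e2 := abs_add_le ((M (y (i + 1)) - 2 * K (y (i + 1))) - (M (y i) - 2 * K (y i)))
          (2 * (K (y (i + 1)) - K (y i)))
        rw [abs_of_nonneg (a := 2 * (K (y (i + 1)) - K (y i))) (by linarith)] at e2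
        refine le_trans (le_of_eq ?_) e2
        congr 1; ring
    _ = ∑ i ∈ Finset.range n, |(M (y (i + 1)) - 2 * K (y (i + 1))) - (M (y i) - 2 * K (y i))| +
          2 * (K (y n) - K (y 0)) := by
        rw [Finset.sum_add_distrib, ← Finset.mul_sum, htele]
    _ ≤ 19733 * V := by
        have := hKV (y 0) (y n)
        linarith

/-- The defining set of averages of `ntTruncMax`. -/
def ntAverages (α : ℝ) (N f : ℝ → ℝ) (x : ℝ) : Set ℝ :=
  {r : ℝ | ∃ y t : ℝ, 0 < t ∧ t ≤ N x ∧ |x - y| ≤ α * t ∧ r = avgAbs f y t}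

theorem ntAverages_nonempty {α : ℝ} (h0 : 0 ≤ α) {N f : ℝ → ℝ} {x : ℝ} (hN : 0 < N x) :
    (ntAverages α N f x).Nonempty :=
  ⟨_, x, N x, hN, le_rfl, by rw [sub_self, abs_zero]; positivity, rfl⟩

theorem integral_eq_mul_avgAbs {f : ℝ → ℝ} {y t : ℝ} (ht : 0 < t) :
    ∫ s in (y - t)..(y + t), |f s| = 2 * t * avgAbs f y t := by
  unfold avgAbs
  field_simp

theorem eVariationOn_ntTruncMax_le {α : ℝ} (h0 : 0 ≤ α) (h1 : α ≤ 1) {N f : ℝ → ℝ}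
    (hN0 : ∀ x, 0 < N x) (hN : LipschitzWith (Real.toNNReal (1 / (α + 1))) N)
    (hf : BoundedVariationOn f univ) :
    eVariationOn (ntTruncMax α N f) univ ≤ ENNReal.ofReal 19733 * eVariationOn f univ := by
  have hloc := hf.locallyBoundedVariationOn
  set V := (eVariationOn f univ).toReal with hVdef
  set T := variationOnFromTo f univ 0 with hTdef
  set g : ℝ → ℝ := fun x => |f x| with hgdef
  have hTsub : ∀ x y, T y - T x = variationOnFromTo f univ x y := by
    intro x y
    have := variationOnFromTo.add hloc (mem_univ 0) (mem_univ x) (mem_univ y)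
    simp only [hTdef]
    linarith
  have hT : ∀ x y, x ≤ y → |g y - g x| ≤ T y - T x := by
    intro x y hxy
    rw [hTsub, variationOnFromTo.eq_of_le _ _ hxy]
    refine (abs_abs_sub_abs_le (f y) (f x)).trans ?_
    rw [← Real.dist_eq, dist_edist]
    exact ENNReal.toReal_mono (hloc x y (mem_univ _) (mem_univ _))
      (eVariationOn.edist_le _ ⟨mem_univ _, hxy, le_rfl⟩ ⟨mem_univ _, le_rfl, hxy⟩)
  have hV : ∀ x y, x ≤ y → T y - T x ≤ V := by
    intro x y hxy
    rw [hTsub, variationOnFromTo.eq_of_le _ _ hxy]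
    exact ENNReal.toReal_mono hf (eVariationOn.mono _ inter_subset_left)
  have hgV : ∀ x y, g x - g y ≤ V := by
    intro x y
    rcases le_total x y with h | h
    · linarith [hT x y h, hV x y h, neg_abs_le (g y - g x)]
    · linarith [hT y x h, hV y x h, le_abs_self (g x - g y)]
  obtain ⟨p, q, hp, hq, hpq⟩ := hloc.exists_monotoneOn_sub_monotoneOn
  rw [monotoneOn_univ] at hp hq
  have hg : Measurable g := by
    rw [hgdef, hpq]
    exact (hp.measurable.sub hq.measurable).abs
  have hgi : ∀ a b, IntervalIntegrable g volume a b := by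
    intro a b
    rw [hgdef, hpq]
    exact (hp.intervalIntegrable.sub hq.intervalIntegrable).abs
  have hav : ∀ y t y' t', 0 < t → 0 < t' → avgAbs f y t ≤ avgAbs f y' t' + V := by
    intro y t y' t' ht ht'
    obtain ⟨z, -, -, hz⟩ := exists_le_of_mul_le_integral hgi (a := y - t) (b := y + t)
      (K := avgAbs f y t) (by linarith) (by rw [integral_eq_mul_avgAbs ht]; linarith)
    obtain ⟨z', -, -, hz'⟩ := exists_le_of_mul_le_integral (g := fun x => -g x)
      (fun a b => (hgi a b).neg) (a := y' - t') (b := y' + t')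
      (K := -avgAbs f y' t') (by linarith)
      (by rw [intervalIntegral.integral_neg, integral_eq_mul_avgAbs ht']; linarith)
    linarith [hgV z z']
  have hbdd : ∀ x, BddAbove (ntAverages α N f x) := by
    rintro x
    refine ⟨avgAbs f 0 1 + V, ?_⟩
    rintro _ ⟨y, t, ht, -, -, rfl⟩
    exact hav _ _ _ _ ht one_pos
  have hle : ∀ x y, ntTruncMax α N f x ≤ ntTruncMax α N f y + V := by
    intro x y
    refine csSup_le (ntAverages_nonempty h0 (hN0 x)) ?_
    rintro _ ⟨c, t, ht, -, -, rfl⟩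
    obtain ⟨_, c', t', ht', h2, h3, rfl⟩ := ntAverages_nonempty (f := f) h0 (hN0 y)
    have := le_csSup (hbdd y) ⟨c', t', ht', h2, h3, rfl⟩
    exact (hav c t c' t' ht ht').trans (by gcongr; exact this)
  have hN' : ∀ x y, N x - N y ≤ |x - y| / (1 + α) := by
    intro x y
    have := hN.dist_le_mul x y
    rw [Real.dist_eq, Real.dist_eq, Real.coe_toNNReal _ (by positivity)] at this
    calc N x - N y ≤ |N x - N y| := le_abs_self _
      _ ≤ _ := this
      _ = _ := by rw [add_comm α 1]; ring
  have hmain := sum_abs_sub_le_of_isMaximal h0 h1 (M := ntTruncMax α N f) hg hgi hT hV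
    (fun z y t ht htN hzy => by
      rw [integral_eq_mul_avgAbs ht]
      have := le_csSup (hbdd z) ⟨y, t, ht, htN, hzy, rfl⟩
      exact mul_le_mul_of_nonneg_left this (by positivity))
    (fun z b hb => by
      obtain ⟨_, ⟨y, t, ht, htN, hzy, rfl⟩, hbr⟩ :=
        exists_lt_of_lt_csSup (ntAverages_nonempty h0 (hN0 z)) hb
      refine ⟨y, t, ht, htN, hzy, ?_⟩
      rw [integral_eq_mul_avgAbs ht]
      exact mul_le_mul_of_nonneg_left hbr.le (by positivity))
    (fun x y => abs_le.2 ⟨by linarith [hle y x], by linarith [hle x y]⟩) hN0 hN'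
  refine iSup_le fun ⟨n, u, hu, _⟩ => ?_
  calc ∑ i ∈ Finset.range n, edist (ntTruncMax α N f (u (i + 1))) (ntTruncMax α N f (u i))
      = ENNReal.ofReal
          (∑ i ∈ Finset.range n, |ntTruncMax α N f (u (i + 1)) - ntTruncMax α N f (u i)|) := by
        rw [ENNReal.ofReal_sum_of_nonneg fun _ _ => abs_nonneg _]
        exact Finset.sum_congr rfl fun i _ => by rw [edist_dist, Real.dist_eq]
    _ ≤ ENNReal.ofReal (19733 * V) := ENNReal.ofReal_le_ofReal (hmain n u hu)
    _ = _ := by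
        rw [ENNReal.ofReal_mul (by norm_num), hVdef, ENNReal.ofReal_toReal hf]

theorem abs_sub_round_le_abs_sub_add (x y : ℝ) :
    |x - round x| ≤ |x - y| + |y - round y| :=
  (round_le x (round y)).trans (abs_sub_le x y _)

theorem abs_sub_round_natCast_add_half (k : ℕ) :
    |((k : ℝ) + 1 / 2) - round ((k : ℝ) + 1 / 2)| = 1 / 2 := by
  refine le_antisymm (abs_sub_round _) ?_
  set m := round ((k : ℝ) + 1 / 2)
  rcases le_or_gt m k with h | h
  · have : (m : ℝ) ≤ k := by exact_mod_cast h
    exact le_trans (by linarith) (le_abs_self _)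
  · have : (k : ℝ) + 1 ≤ m := by exact_mod_cast h
    exact le_trans (by linarith) (neg_le_abs _)

/-- A truncation function oscillating around the critical slope `1 / (1 + α)`. -/
noncomputable def sawtooth (α γ x : ℝ) : ℝ :=
  (max x 1 + γ * |max x 1 - round (max x 1)|) / (1 + α)

theorem sawtooth_pos {α γ : ℝ} (h0 : 0 ≤ α) (hγ : 0 < γ) (x : ℝ) : 0 < sawtooth α γ x := by
  have h1 : (1 : ℝ) ≤ max x 1 := le_max_right _ _
  unfold sawtooth
  positivity

theorem sawtooth_natCast_add_one (α γ : ℝ) (k : ℕ) :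
    sawtooth α γ (k + 1) = (k + 1) / (1 + α) := by
  have h1 : max ((k : ℝ) + 1) 1 = ((k + 1 : ℕ) : ℝ) := by
    rw [max_eq_left (by have := k.cast_nonneg (α := ℝ); linarith)]; push_cast; ring
  unfold sawtooth
  rw [h1, round_natCast]
  simp

theorem sawtooth_natCast_add_half (α γ : ℝ) (k : ℕ) :
    sawtooth α γ ((k + 1 : ℕ) + 1 / 2) = ((k + 1 : ℕ) + 1 / 2 + γ / 2) / (1 + α) := by
  unfold sawtooth
  rw [max_eq_left (by push_cast; have := k.cast_nonneg (α := ℝ); linarith),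
    abs_sub_round_natCast_add_half]
  ring

theorem lipConst_sawtooth {α γ : ℝ} (h0 : 0 ≤ α) (hγ : 0 < γ) :
    lipConst (sawtooth α γ) = ENNReal.ofReal ((1 + γ) / (1 + α)) := by
  apply le_antisymm
  · refine iSup_le fun x => iSup_le fun y => iSup_le fun hxy => ENNReal.ofReal_le_ofReal ?_
    have hpos : 0 < |x - y| := abs_pos.2 (sub_ne_zero.2 hxy)
    rw [div_le_iff₀ hpos]
    have hone : ∀ x y, sawtooth α γ x - sawtooth α γ y ≤ (1 + γ) / (1 + α) * |x - y| := by
      intro x y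
      have e1 : |max x 1 - max y 1| ≤ |x - y| := abs_max_sub_max_le_abs x y 1
      have e2 := abs_sub_round_le_abs_sub_add (max x 1) (max y 1)
      have e3 := le_abs_self (max x 1 - max y 1)
      unfold sawtooth
      rw [← _root_.sub_div, div_mul_eq_mul_div]
      gcongr
      nlinarith
    exact abs_le.2 ⟨by have := hone y x; rw [abs_sub_comm] at this; linarith, hone x y⟩
  · refine le_trans ?_ (le_iSup_of_le ((1 + 1 / 2 : ℝ)) (le_iSup_of_le (1 : ℝ)
      (le_iSup_of_le (by norm_num) le_rfl)))
    refine ENNReal.ofReal_le_ofReal ?_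
    have e1 := sawtooth_natCast_add_half α γ 0
    have e2 := sawtooth_natCast_add_one α γ 0
    norm_num at e1 e2 ⊢
    rw [e1, e2]
    have : (3 / 2 + γ / 2) / (1 + α) - (1 + α)⁻¹ = (1 + γ) / (1 + α) / 2 := by
      field_simp; ring
    rw [this, abs_of_nonneg (by positivity)]
    linarith

theorem intervalIntegrable_abs_indicator_Ioo (a b : ℝ) :
    IntervalIntegrable (fun s => |(Ioo (-1 : ℝ) 0).indicator (fun _ => (1 : ℝ)) s|) volume a b := by
  have : Integrable ((Ioo (-1 : ℝ) 0).indicator fun _ => (1 : ℝ)) :=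
    (integrable_indicator_iff measurableSet_Ioo).2 (integrableOn_const (by simp))
  exact this.abs.intervalIntegrable

theorem ntTruncMax_sawtooth_natCast {α γ : ℝ} (h0 : 0 ≤ α) (k : ℕ) :
    ntTruncMax α (sawtooth α γ) ((Ioo (-1 : ℝ) 0).indicator fun _ => 1) (k + 1) ≤ 0 := by
  refine Real.sSup_nonpos ?_
  rintro _ ⟨y, t, ht, htN, hy, rfl⟩
  rw [sawtooth_natCast_add_one, le_div_iff₀ (by positivity)] at htN
  have h1 := (abs_le.1 hy).2
  have h2 : 0 ≤ y - t := by linarith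
  have : ∫ s in (y - t)..(y + t), |(Ioo (-1 : ℝ) 0).indicator (fun _ => (1 : ℝ)) s| =
      ∫ s in (y - t)..(y + t), (0 : ℝ) := by
    refine intervalIntegral.integral_congr fun s hs => ?_
    rw [uIcc_of_le (by linarith)] at hs
    have : s ∉ Ioo (-1 : ℝ) 0 := fun h => by linarith [h.2, hs.1]
    simp [indicator_of_notMem this]
  unfold avgAbs
  rw [this]
  simp

theorem le_ntTruncMax_sawtooth {α γ : ℝ} (h0 : 0 ≤ α) (h1 : α ≤ 1) (hγ : 0 < γ) (k : ℕ) :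
    min 1 (γ / 2) / (3 + γ) * (1 / ((k : ℝ) + 1)) ≤
      ntTruncMax α (sawtooth α γ) ((Ioo (-1 : ℝ) 0).indicator fun _ => 1)
        ((k + 1 : ℕ) + 1 / 2) := by
  set x : ℝ := (k + 1 : ℕ) + 1 / 2 with hx
  set δ := min 1 (γ / 2) with hδ
  have hδ0 : 0 < δ := lt_min one_pos (by linarith)
  have hxv : x = k + 3 / 2 := by rw [hx]; push_cast; ring
  have hk : (0 : ℝ) ≤ k := k.cast_nonneg
  have hN : sawtooth α γ x = (x + γ / 2) / (1 + α) := sawtooth_natCast_add_half α γ k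
  set t := sawtooth α γ x with ht
  have ht0 : 0 < t := sawtooth_pos h0 hγ x
  have htx : t * (1 + α) = x + γ / 2 := by rw [hN]; field_simp
  have hbdd : BddAbove (ntAverages α (sawtooth α γ) ((Ioo (-1 : ℝ) 0).indicator fun _ => 1) x) := by
    refine ⟨1, ?_⟩
    rintro _ ⟨y, t, ht, -, -, rfl⟩
    have : ∫ s in (y - t)..(y + t), |(Ioo (-1 : ℝ) 0).indicator (fun _ => (1 : ℝ)) s| ≤
        ∫ s in (y - t)..(y + t), (1 : ℝ) := by
      refine intervalIntegral.integral_mono_on (by linarith)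
        (intervalIntegrable_abs_indicator_Ioo _ _) intervalIntegrable_const fun s _ => ?_
      rw [indicator_apply]
      split_ifs <;> simp
    rw [intervalIntegral.integral_const, smul_eq_mul, integral_eq_mul_avgAbs ht] at this
    exact le_of_mul_le_mul_left (by linarith) (by positivity : 0 < 2 * t)
  have hmem := le_csSup hbdd ⟨x - α * t, t, ht0, le_rfl,
    by rw [_root_.sub_sub_cancel, abs_of_nonneg (by positivity)], rfl⟩
  refine le_trans ?_ hmem
  have hint : δ ≤ ∫ s in (x - α * t - t)..(x - α * t + t),
      |(Ioo (-1 : ℝ) 0).indicator (fun _ => (1 : ℝ)) s| := by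
    calc δ = ∫ s in (-δ)..0, (1 : ℝ) := by simp
      _ ≤ ∫ s in (-δ)..0, |(Ioo (-1 : ℝ) 0).indicator (fun _ => (1 : ℝ)) s| := by
        refine intervalIntegral.integral_mono_on_of_le_Ioo (by linarith) intervalIntegrable_const
          (intervalIntegrable_abs_indicator_Ioo _ _) fun s hs => ?_
        have : s ∈ Ioo (-1 : ℝ) 0 := ⟨by linarith [hs.1, min_le_left 1 (γ / 2)], hs.2⟩
        simp [indicator_of_mem this]
      _ ≤ _ := by
        refine intervalIntegral.integral_mono_interval ?_ (by linarith) ?_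
          (Eventually.of_forall fun _ => abs_nonneg _) (intervalIntegrable_abs_indicator_Ioo _ _)
        · have := min_le_right 1 (γ / 2)
          linarith
        · nlinarith
  rw [integral_eq_mul_avgAbs ht0] at hint
  rw [div_mul_div_comm, mul_one, div_le_iff₀ (by positivity)]
  refine hint.trans ?_
  rw [mul_comm]
  have h2t : 2 * t ≤ (3 + γ) * (k + 1) := by nlinarith
  refine mul_le_mul_of_nonneg_left h2t (le_of_mul_le_mul_left ?_ (by positivity : 0 < 2 * t))
  rw [mul_zero]
  exact hδ0.le.trans hint

theorem eVariationOn_ntTruncMax_sawtooth {α γ : ℝ} (h0 : 0 ≤ α) (h1 : α ≤ 1) (hγ : 0 < γ) :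
    eVariationOn (ntTruncMax α (sawtooth α γ) ((Ioo (-1 : ℝ) 0).indicator fun _ => 1)) univ = ⊤ := by
  set M := ntTruncMax α (sawtooth α γ) ((Ioo (-1 : ℝ) 0).indicator fun _ => 1) with hM
  by_contra htop
  set a : ℕ → ℝ := fun k => min 1 (γ / 2) / (3 + γ) * (1 / ((k : ℝ) + 1)) with ha
  have hδ : 0 < min 1 (γ / 2) / (3 + γ) := div_pos (lt_min one_pos (by linarith)) (by linarith)
  have ha0 : ∀ k, 0 ≤ a k := fun k => by positivity
  set u : ℕ → ℝ := fun i => 1 + i / 2 with hu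
  have humono : Monotone u := fun i j hij => by
    have : (i : ℝ) ≤ j := by exact_mod_cast hij
    simp only [hu]; linarith
  have hstep : ∀ k, ENNReal.ofReal (a k) ≤ edist (M (u (2 * k + 1))) (M (u (2 * k))) := by
    intro k
    have e1 : u (2 * k) = k + 1 := by simp only [hu]; push_cast; ring
    have e2 : u (2 * k + 1) = (k + 1 : ℕ) + 1 / 2 := by simp only [hu]; push_cast; ring
    rw [edist_dist, Real.dist_eq, e1, e2]
    refine ENNReal.ofReal_le_ofReal (le_trans ?_ (le_abs_self _))
    have := le_ntTruncMax_sawtooth h0 h1 hγ k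
    have := ntTruncMax_sawtooth_natCast (γ := γ) h0 k
    simp only [ha]
    linarith
  have hsum : ∀ n, ENNReal.ofReal (∑ k ∈ Finset.range n, a k) ≤
      ∑ i ∈ Finset.range (2 * n), edist (M (u (i + 1))) (M (u i)) := by
    intro n
    rw [ENNReal.ofReal_sum_of_nonneg fun k _ => ha0 k]
    induction n with
    | zero => simp
    | succ n ih =>
      rw [Finset.sum_range_succ, show 2 * (n + 1) = 2 * n + 1 + 1 by ring, Finset.sum_range_succ,
        Finset.sum_range_succ]
      exact (add_le_add ih (hstep n)).trans le_self_add
  have hsummable : Summable a := by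
    refine summable_of_sum_range_le (c := (eVariationOn M univ).toReal) ha0 fun n => ?_
    rw [← ENNReal.ofReal_le_iff_le_toReal htop]
    exact (hsum n).trans (eVariationOn.sum_le humono fun _ => mem_univ _)
  have h2 : Summable fun k : ℕ => 1 / ((k : ℝ) + 1) := (summable_mul_left_iff hδ.ne').1 hsummable
  have h3 : Summable fun k : ℕ => 1 / (k : ℝ) := by
    rw [← _root_.summable_nat_add_iff 1]
    simpa using h2
  exact Real.not_summable_one_div_natCast h3

/-- There is an absolute constant `C` (independent of `α`, `N` and `f`) such that for all
`α ∈ [0,1]`, all `N : ℝ → (0, ∞)` with `Lip(N) ≤ 1/(α+1)` and all `f` of bounded variation,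
`V(M^α_N f) ≤ C · V(f)`. Moreover, for every `β > 1/(α+1)` there is `N_β : ℝ → (0, ∞)` with
`Lip(N_β) = β` such that `V(M^α_{N_β} χ_{(-1,0)}) = ∞`. -/
theorem ntTruncMax_variation_bound_and_counterexample :
    ∃ C : ℝ≥0∞, C ≠ ⊤ ∧
      (∀ α : ℝ, α ∈ Set.Icc (0 : ℝ) 1 → ∀ N : ℝ → ℝ, (∀ x, 0 < N x) →
        LipschitzWith (Real.toNNReal (1 / (α + 1))) N →
        ∀ f : ℝ → ℝ, BoundedVariationOn f Set.univ →
          eVariationOn (ntTruncMax α N f) Set.univ ≤ C * eVariationOn f Set.univ) ∧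
      (∀ α : ℝ, α ∈ Set.Icc (0 : ℝ) 1 → ∀ β : ℝ, 1 / (α + 1) < β →
        ∃ N : ℝ → ℝ, (∀ x, 0 < N x) ∧ lipConst N = ENNReal.ofReal β ∧
          eVariationOn
            (ntTruncMax α N (Set.indicator (Set.Ioo (-1 : ℝ) 0) (fun _ => (1 : ℝ))))
            Set.univ = ⊤) := by
  refine ⟨ENNReal.ofReal 19733, ENNReal.ofReal_ne_top, ?_, ?_⟩
  · intro α hα N hN0 hN f hf
    exact eVariationOn_ntTruncMax_le hα.1 hα.2 hN0 hN hf
  · intro α hα β hβ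
    have h0 : 0 < α + 1 := by linarith [hα.1]
    have hγ : 0 < (1 + α) * β - 1 := by
      rw [div_lt_iff₀ h0] at hβ
      linarith
    refine ⟨sawtooth α ((1 + α) * β - 1), sawtooth_pos hα.1 hγ, ?_,
      eVariationOn_ntTruncMax_sawtooth hα.1 hα.2 hγ⟩
    rw [lipConst_sawtooth hα.1 hγ]
    congr 1
    have : 1 + α ≠ 0 := by linarith
    field_simp
    ring
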